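/- The extended weak order for U₃ is a lattice: any two biclosed subsets of Φ⁺ have a least upper bound and a greatest lower bound in the poset of biclosed subsets of Φ⁺ ordered by inclusion. -/

import Mathlib

open scoped NNReal

noncomputable section

/-- The ambient vector space `V = ℝ³`. -/
abbrev V : Type := Fin 3 → ℝ

/-- The symmetric bilinear form with `⟨αᵢ,αⱼ⟩ = 1` if `i = j` and `-1` otherwise. -/
def B (x y : V) : ℝ := 2 * (∑ i, x i * y i) - (∑ i, x i) * (∑ i, y i)

/-- The associated quadratic form. -/
def Q (x : V) : ℝ := B x x

/-- The simple roots `α₁, α₂, α₃` (the standard basis vectors). -/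
def α (i : Fin 3) : V := Pi.single i 1

/-- The set of simple roots. -/
def Δ : Set V := Set.range α

/-- `f` is the reflection `r_{αᵢ} : x ↦ x - 2⟨αᵢ,x⟩αᵢ` for some `i` (note `⟨αᵢ,αᵢ⟩ = 1`). -/
def IsSimpleReflection (f : V ≃ₗ[ℝ] V) : Prop :=
  ∃ i : Fin 3, ∀ x : V, f x = x - (2 * B (α i) x) • α i

/-- The group `W ≤ GL(V)` generated by the three simple reflections:
the standard reflection representation of `U₃`. -/
def W : Subgroup (V ≃ₗ[ℝ] V) := Subgroup.closure {f | IsSimpleReflection f}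

/-- The root system `Φ = {w·αᵢ : w ∈ W, i ∈ {1,2,3}}`. -/
def Φ : Set V := {x | ∃ w ∈ W, ∃ i : Fin 3, x = w (α i)}

/-- `Span_{≥0}(X)`: the set of nonnegative linear combinations of elements of `X`. -/
def nnspan (X : Set V) : Set V := (Submodule.span ℝ≥0 X : Set V)

/-- The positive roots `Φ⁺ = Φ ∩ Span_{≥0}(Δ)`. -/
def Φpos : Set V := Φ ∩ nnspan Δ

/-- `R ⊆ Φ⁺` is closed if for all `a, b ∈ R`, `Span_{≥0}{a,b} ∩ Φ⁺ ⊆ R`. -/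
def IsClosedSet (R : Set V) : Prop := ∀ a ∈ R, ∀ b ∈ R, nnspan {a, b} ∩ Φpos ⊆ R

/-- `R` is a biclosed subset of `Φ⁺`. -/
def IsBiclosed (R : Set V) : Prop := R ⊆ Φpos ∧ IsClosedSet R ∧ IsClosedSet (Φpos \ R)

theorem mem_nnspan_pair {a b z : V} :
    z ∈ nnspan {a, b} ↔ ∃ s t : ℝ, 0 ≤ s ∧ 0 ≤ t ∧ z = s • a + t • b := by
  simp only [nnspan, SetLike.mem_coe, Submodule.mem_span_pair]
  constructor
  · rintro ⟨s, t, rfl⟩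
    exact ⟨s, t, s.2, t.2, rfl⟩
  · rintro ⟨s, t, hs, ht, rfl⟩
    exact ⟨⟨s, hs⟩, ⟨t, ht⟩, rfl⟩

theorem nnspan_smul_mem {X : Set V} {x : V} (hx : x ∈ nnspan X) {c : ℝ} (hc : 0 ≤ c) :
    c • x ∈ nnspan X :=
  Submodule.smul_mem (Submodule.span ℝ≥0 X) ⟨c, hc⟩ hx

theorem nnspan_add_mem {X : Set V} {x y : V} (hx : x ∈ nnspan X) (hy : y ∈ nnspan X) :
    x + y ∈ nnspan X :=
  Submodule.add_mem (Submodule.span ℝ≥0 X) hx hy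

theorem nnspan_mono {X Y : Set V} (h : X ⊆ Y) : nnspan X ⊆ nnspan Y :=
  Submodule.span_mono h

theorem subset_nnspan {X : Set V} : X ⊆ nnspan X := Submodule.subset_span

theorem mem_nnspan_Δ {x : V} : x ∈ nnspan Δ ↔ ∀ i, 0 ≤ x i := by
  constructor
  · intro hx
    have hx' : x ∈ Submodule.span ℝ≥0 Δ := hx
    clear hx
    induction hx' using Submodule.span_induction with
    | mem x h =>
      obtain ⟨i, rfl⟩ := h
      intro j
      by_cases hij : j = i
      · subst hij; simp [α]
      · simp [α, hij]
    | zero => simp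
    | add x y hx hy h1 h2 => exact fun i => add_nonneg (h1 i) (h2 i)
    | smul a x hx h => exact fun i => mul_nonneg a.2 (h i)
  · intro h
    have hsum : x = x 0 • α 0 + x 1 • α 1 + x 2 • α 2 := by
      ext i; fin_cases i <;> simp [α]
    rw [hsum]
    refine nnspan_add_mem (nnspan_add_mem ?_ ?_) ?_ <;>
      exact nnspan_smul_mem (subset_nnspan (Set.mem_range_self _)) (h _)

theorem B_eq (x y : V) : B x y = 2 * (x 0 * y 0 + x 1 * y 1 + x 2 * y 2) -
    (x 0 + x 1 + x 2) * (y 0 + y 1 + y 2) := by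
  simp [B, Fin.sum_univ_three]

theorem B_α (i : Fin 3) (x : V) : B (α i) x = 2 * x i - (x 0 + x 1 + x 2) := by
  rw [B_eq]
  fin_cases i <;> simp [α]

/-- The reflection `x ↦ x - 2⟨αᵢ,x⟩αᵢ` as a linear map. -/
def reflLin (i : Fin 3) : V →ₗ[ℝ] V where
  toFun x := x - (2 * B (α i) x) • α i
  map_add' x y := by
    ext j; simp only [B_α, Pi.add_apply, Pi.sub_apply, Pi.smul_apply, smul_eq_mul]; ring
  map_smul' c x := by
    ext j
    simp only [B_α, Pi.sub_apply, Pi.smul_apply, smul_eq_mul, RingHom.id_apply]; ring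

/-- The simple reflection `r_{αᵢ}` as a linear equivalence. -/
def srefl (i : Fin 3) : V ≃ₗ[ℝ] V :=
  LinearEquiv.ofInvolutive (reflLin i) (by
    intro x
    simp only [reflLin, LinearMap.coe_mk, AddHom.coe_mk, B_α]
    ext j
    fin_cases i <;> fin_cases j <;> simp [α] <;> ring)

theorem refl_apply (i : Fin 3) (x : V) : srefl i x = x - (2 * B (α i) x) • α i := rfl

theorem isSimpleReflection_refl (i : Fin 3) : IsSimpleReflection (srefl i) := ⟨i, fun _ => rfl⟩

theorem refl_refl (i : Fin 3) (x : V) : srefl i (srefl i x) = x := by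
  simp only [refl_apply, B_α]
  ext j
  fin_cases i <;> fin_cases j <;> simp [α] <;> ring

theorem refl_mem_Φ (i : Fin 3) {x : V} (hx : x ∈ Φ) : srefl i x ∈ Φ := by
  obtain ⟨w, hw, j, rfl⟩ := hx
  exact ⟨srefl i * w, W.mul_mem (Subgroup.subset_closure (isSimpleReflection_refl i)) hw, j, rfl⟩

theorem mem_Φ_of_refl (i : Fin 3) {x : V} (hx : srefl i x ∈ Φ) : x ∈ Φ := by
  have := refl_mem_Φ i hx
  rwa [refl_refl] at this

theorem α_mem_Φ (i : Fin 3) : α i ∈ Φ := ⟨1, W.one_mem, i, rfl⟩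

theorem neg_mem_Φ {x : V} (hx : x ∈ Φ) : -x ∈ Φ := by
  obtain ⟨w, hw, j, rfl⟩ := hx
  refine ⟨w * srefl j,
    W.mul_mem hw (Subgroup.subset_closure (isSimpleReflection_refl j)), j, ?_⟩
  have : srefl j (α j) = - α j := by
    rw [refl_apply, B_α]
    ext i
    fin_cases j <;> fin_cases i <;> simp [α] <;> norm_num
  rw [LinearEquiv.mul_apply, this, map_neg]

theorem neg_mem_Φ_iff {x : V} : -x ∈ Φ ↔ x ∈ Φ :=
  ⟨fun h => by simpa using neg_mem_Φ h, neg_mem_Φ⟩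

/-- The determinant of a pair of integer vectors. -/
def det2 (u v : ℤ × ℤ) : ℤ := u.1 * v.2 - u.2 * v.1

/-- The pair `u, v` is a basis of `ℤ²`. -/
def Unimod (u v : ℤ × ℤ) : Prop := det2 u v * det2 u v = 1

/-- The symmetric bilinear map `ℤ² × ℤ² → V` whose values on bases are the roots. -/
def edgeRoot (u v : ℤ × ℤ) : V :=
  ![(((u.1 + u.2) * (v.1 + v.2) : ℤ) : ℝ), ((u.1 * v.1 : ℤ) : ℝ), ((u.2 * v.2 : ℤ) : ℝ)]

theorem edgeRoot_stable (i : Fin 3) {u v : ℤ × ℤ} (h : Unimod u v) :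
    ∃ u' v', Unimod u' v' ∧ srefl i (edgeRoot u v) = edgeRoot u' v' := by
  obtain ⟨a, b⟩ := u
  obtain ⟨c, d⟩ := v
  simp only [Unimod, det2] at h
  fin_cases i
  · refine ⟨(a, -b), (c, -d), ?_, ?_⟩
    · simp only [Unimod, det2]; linear_combination h
    · rw [refl_apply, B_α]
      ext j; fin_cases j <;> simp [edgeRoot, α] <;> ring
  · refine ⟨(a + 2 * b, -b), (c + 2 * d, -d), ?_, ?_⟩
    · simp only [Unimod, det2]; linear_combination h
    · rw [refl_apply, B_α]
      ext j; fin_cases j <;> simp [edgeRoot, α] <;> ring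
  · refine ⟨(-a, b + 2 * a), (-c, d + 2 * c), ?_, ?_⟩
    · simp only [Unimod, det2]; linear_combination h
    · rw [refl_apply, B_α]
      ext j; fin_cases j <;> simp [edgeRoot, α] <;> ring

theorem α_eq_edgeRoot (i : Fin 3) : ∃ u v, Unimod u v ∧ α i = edgeRoot u v := by
  fin_cases i
  · refine ⟨(1, 0), (0, 1), by norm_num [Unimod, det2], ?_⟩
    ext j; fin_cases j <;> simp [edgeRoot, α]
  · refine ⟨(1, 0), (1, -1), by norm_num [Unimod, det2], ?_⟩
    ext j; fin_cases j <;> simp [edgeRoot, α]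
  · refine ⟨(0, 1), (-1, 1), by norm_num [Unimod, det2], ?_⟩
    ext j; fin_cases j <;> simp [edgeRoot, α]

theorem exists_edgeRoot {x : V} (hx : x ∈ Φ) : ∃ u v, Unimod u v ∧ x = edgeRoot u v := by
  obtain ⟨w, hw, j, rfl⟩ := hx
  have key : ∀ x, (∃ u v, Unimod u v ∧ w x = edgeRoot u v) ↔
      ∃ u v, Unimod u v ∧ x = edgeRoot u v := by
    induction hw using Subgroup.closure_induction with
    | mem f hf =>
      obtain ⟨i, hi⟩ := hf
      intro x
      have hfx : f x = srefl i x := hi x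
      rw [hfx]
      constructor
      · rintro ⟨u, v, h, e⟩
        obtain ⟨u', v', h', e'⟩ := edgeRoot_stable i h
        exact ⟨u', v', h', by rw [← e', ← e, refl_refl]⟩
      · rintro ⟨u, v, h, e⟩
        obtain ⟨u', v', h', e'⟩ := edgeRoot_stable i h
        exact ⟨u', v', h', by rw [e, e']⟩
    | one => intro x; rfl
    | mul f g _ _ hf hg =>
      intro x
      rw [LinearEquiv.mul_apply, hf, hg]
    | inv f _ hf =>
      intro x
      rw [← hf (f⁻¹ x)]
      have : f (f⁻¹ x) = x := f.apply_symm_apply x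
      rw [this]
  exact (key _).2 (α_eq_edgeRoot j)

theorem int_sign_coherent {a b c : ℤ}
    (h : 2 * (a * a + b * b + c * c) - (a + b + c) * (a + b + c) = 1) :
    (0 ≤ a ∧ 0 ≤ b ∧ 0 ≤ c) ∨ (a ≤ 0 ∧ b ≤ 0 ∧ c ≤ 0) := by
  have hab : 0 ≤ a * b := by
    by_contra hn
    nlinarith [sq_nonneg (c - a - b)]
  have hac : 0 ≤ a * c := by
    by_contra hn
    nlinarith [sq_nonneg (b - a - c)]
  have hbc : 0 ≤ b * c := by
    by_contra hn
    nlinarith [sq_nonneg (a - b - c)]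
  rcases lt_trichotomy a 0 with ha | ha | ha
  · right; exact ⟨ha.le, by nlinarith, by nlinarith⟩
  · subst ha
    rcases lt_trichotomy b 0 with hb | hb | hb
    · right; exact ⟨le_rfl, hb.le, by nlinarith⟩
    · subst hb
      rcases le_total 0 c with hc | hc
      · left; simp [hc]
      · right; simp [hc]
    · left; exact ⟨le_rfl, hb.le, by nlinarith⟩
  · left; exact ⟨ha.le, by nlinarith, by nlinarith⟩

theorem int_mem_Φ_aux (n : ℕ) : ∀ a b c : ℤ, |a| + |b| + |c| < n →
    2 * (a * a + b * b + c * c) - (a + b + c) * (a + b + c) = 1 →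
    ![(a : ℝ), (b : ℝ), (c : ℝ)] ∈ Φ := by
  induction n with
  | zero =>
    intro a b c h
    have := abs_nonneg a; have := abs_nonneg b; have := abs_nonneg c
    push_cast at h; omega
  | succ n ih =>
    have pos : ∀ a b c : ℤ, |a| + |b| + |c| < (n + 1 : ℕ) →
        2 * (a * a + b * b + c * c) - (a + b + c) * (a + b + c) = 1 →
        0 ≤ a → 0 ≤ b → 0 ≤ c → ![(a : ℝ), (b : ℝ), (c : ℝ)] ∈ Φ := by
      intro a b c hn h ha hb hc
      rw [abs_of_nonneg ha, abs_of_nonneg hb, abs_of_nonneg hc] at hn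
      push_cast at hn
      have hdesc : (0 < a ∧ 0 < a - b - c) ∨ (0 < b ∧ 0 < b - a - c) ∨
          (0 < c ∧ 0 < c - a - b) := by
        by_contra hcon
        push Not at hcon
        obtain ⟨h1, h2, h3⟩ := hcon
        have e1 : a * (a - b - c) ≤ 0 := by
          rcases ha.eq_or_lt with h | h
          · simp [← h]
          · exact mul_nonpos_of_nonneg_of_nonpos ha (h1 h)
        have e2 : b * (b - a - c) ≤ 0 := by
          rcases hb.eq_or_lt with h | h
          · simp [← h]
          · exact mul_nonpos_of_nonneg_of_nonpos hb (h2 h)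
        have e3 : c * (c - a - b) ≤ 0 := by
          rcases hc.eq_or_lt with h | h
          · simp [← h]
          · exact mul_nonpos_of_nonneg_of_nonpos hc (h3 h)
        nlinarith
      have zero_case : ∀ x : ℤ, 0 < x → x * x = 1 → x = 1 := by
        intro x hx hxx; nlinarith
      rcases hdesc with ⟨h1, h2⟩ | ⟨h1, h2⟩ | ⟨h1, h2⟩
      · by_cases hz : b + c = 0
        · obtain rfl : b = 0 := by omega
          obtain rfl : c = 0 := by omega
          obtain rfl := zero_case a h1 (by linarith)
          convert α_mem_Φ 0 using 1
          ext j; fin_cases j <;> simp [α]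
        · apply mem_Φ_of_refl 0
          convert ih (-a + 2 * b + 2 * c) b c ?_ ?_ using 1
          · rw [refl_apply, B_α]
            ext j; fin_cases j <;> simp [α] <;> ring
          · rw [abs_of_nonneg hb, abs_of_nonneg hc]
            have : |-a + 2 * b + 2 * c| < a := by rw [abs_lt]; omega
            omega
          · linarith
      · by_cases hz : a + c = 0
        · obtain rfl : a = 0 := by omega
          obtain rfl : c = 0 := by omega
          obtain rfl := zero_case b h1 (by linarith)
          convert α_mem_Φ 1 using 1
          ext j; fin_cases j <;> simp [α]
        · apply mem_Φ_of_refl 1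
          convert ih a (-b + 2 * a + 2 * c) c ?_ ?_ using 1
          · rw [refl_apply, B_α]
            ext j; fin_cases j <;> simp [α] <;> ring
          · rw [abs_of_nonneg ha, abs_of_nonneg hc]
            have : |-b + 2 * a + 2 * c| < b := by rw [abs_lt]; omega
            omega
          · linarith
      · by_cases hz : a + b = 0
        · obtain rfl : a = 0 := by omega
          obtain rfl : b = 0 := by omega
          obtain rfl := zero_case c h1 (by linarith)
          convert α_mem_Φ 2 using 1
          ext j; fin_cases j <;> simp [α]
        · apply mem_Φ_of_refl 2
          convert ih a b (-c + 2 * a + 2 * b) ?_ ?_ using 1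
          · rw [refl_apply, B_α]
            ext j; fin_cases j <;> simp [α] <;> ring
          · rw [abs_of_nonneg ha, abs_of_nonneg hb]
            have : |-c + 2 * a + 2 * b| < c := by rw [abs_lt]; omega
            omega
          · linarith
    intro a b c hn h
    rcases int_sign_coherent h with ⟨ha, hb, hc⟩ | ⟨ha, hb, hc⟩
    · exact pos a b c hn h ha hb hc
    · have := pos (-a) (-b) (-c) (by simpa using hn) (by linarith) (by omega) (by omega)
        (by omega)
      rw [← neg_mem_Φ_iff]
      convert this using 1
      ext j; fin_cases j <;> simp

theorem edgeRoot_mem_Φ {u v : ℤ × ℤ} (h : Unimod u v) : edgeRoot u v ∈ Φ := by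
  refine int_mem_Φ_aux (Int.toNat (|(u.1 + u.2) * (v.1 + v.2)| + |u.1 * v.1| + |u.2 * v.2|) + 1)
    _ _ _ ?_ ?_
  · push_cast
    have := Int.self_le_toNat (|(u.1 + u.2) * (v.1 + v.2)| + |u.1 * v.1| + |u.2 * v.2|)
    omega
  · simp only [Unimod, det2] at h
    linear_combination h

theorem mem_Φ_iff {x : V} : x ∈ Φ ↔ ∃ u v, Unimod u v ∧ x = edgeRoot u v :=
  ⟨exists_edgeRoot, by rintro ⟨u, v, h, rfl⟩; exact edgeRoot_mem_Φ h⟩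

theorem mem_Φpos_iff {x : V} : x ∈ Φpos ↔ x ∈ Φ ∧ ∀ i, 0 ≤ x i := by
  rw [Φpos, Set.mem_inter_iff, mem_nnspan_Δ]

theorem Φ_pos_or_neg {x : V} (hx : x ∈ Φ) : x ∈ Φpos ∨ -x ∈ Φpos := by
  rw [mem_Φpos_iff, mem_Φpos_iff, neg_mem_Φ_iff]
  obtain ⟨u, v, h, rfl⟩ := exists_edgeRoot hx
  have hQ : 2 * (((u.1 + u.2) * (v.1 + v.2)) * ((u.1 + u.2) * (v.1 + v.2)) +
      (u.1 * v.1) * (u.1 * v.1) + (u.2 * v.2) * (u.2 * v.2)) -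
      ((u.1 + u.2) * (v.1 + v.2) + u.1 * v.1 + u.2 * v.2) *
      ((u.1 + u.2) * (v.1 + v.2) + u.1 * v.1 + u.2 * v.2) = 1 := by
    simp only [Unimod, det2] at h
    linear_combination h
  rcases int_sign_coherent hQ with ⟨ha, hb, hc⟩ | ⟨ha, hb, hc⟩
  · left
    refine ⟨hx, fun i => ?_⟩
    fin_cases i
    · exact Int.cast_nonneg ha
    · exact Int.cast_nonneg hb
    · exact Int.cast_nonneg hc
  · right
    refine ⟨hx, fun i => ?_⟩
    rw [Pi.neg_apply, neg_nonneg]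
    fin_cases i
    · exact Int.cast_nonpos.2 ha
    · exact Int.cast_nonpos.2 hb
    · exact Int.cast_nonpos.2 hc

theorem ne_zero_of_mem_Φ {x : V} (hx : x ∈ Φ) : x ≠ 0 := by
  obtain ⟨w, _, i, rfl⟩ := hx
  intro h
  have h0 : α i = 0 := by simpa using h
  have := congrFun h0 i
  simp [α] at this

/-- A set of roots containing exactly one root of each pair `x, -x` and closed under
nonnegative combinations of two of its elements. -/
structure HalfSystem (P : Set V) : Prop where
  sub : P ⊆ Φ
  total : ∀ x ∈ Φ, x ∈ P ∨ -x ∈ P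
  asymm : ∀ x ∈ P, -x ∉ P
  closed : ∀ x ∈ P, ∀ y ∈ P, ∀ s t : ℝ, 0 ≤ s → 0 ≤ t → s • x + t • y ∈ Φ → s • x + t • y ∈ P

namespace HalfSystem

variable {P : Set V}

theorem not_mem_iff (hP : HalfSystem P) {x : V} (hx : x ∈ Φ) : x ∉ P ↔ -x ∈ P :=
  ⟨fun h => (hP.total x hx).resolve_left h, fun h h' => hP.asymm x h' h⟩

theorem neg (hP : HalfSystem P) : HalfSystem {x | -x ∈ P} where
  sub := fun x hx => neg_mem_Φ_iff.1 (hP.sub hx)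
  total := fun x hx => by
    simp only [Set.mem_ofPred_eq, neg_neg]
    exact (hP.total x hx).symm
  asymm := fun x hx hx' => hP.asymm _ hx hx'
  closed := fun x hx y hy s t hs ht h => by
    have e : -(s • x + t • y) = s • (-x) + t • (-y) := by simp only [smul_neg]; abel
    simp only [Set.mem_ofPred_eq]
    rw [← neg_mem_Φ_iff, e] at h
    rw [e]
    exact hP.closed _ hx _ hy s t hs ht h

theorem closed_smul (hP : HalfSystem P) {x y z : V} (hx : x ∈ P) (hy : y ∈ P) (hz : z ∈ Φ)
    {c s t : ℝ} (hc : 0 < c) (hs : 0 ≤ s) (ht : 0 ≤ t) (h : c • z = s • x + t • y) : z ∈ P := by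
  have e : z = (s / c) • x + (t / c) • y := by
    have : z = c⁻¹ • (c • z) := by rw [smul_smul, inv_mul_cancel₀ hc.ne', one_smul]
    rw [this, h, smul_add, smul_smul, smul_smul, div_eq_inv_mul, div_eq_inv_mul]
  rw [e] at hz ⊢
  exact hP.closed x hx y hy _ _ (div_nonneg hs hc.le) (div_nonneg ht hc.le) hz

end HalfSystem

theorem nonneg_of_mem_Φpos {x : V} (hx : x ∈ Φpos) (i : Fin 3) : 0 ≤ x i :=
  (mem_Φpos_iff.1 hx).2 i

theorem ne_zero_of_mem_Φpos {x : V} (hx : x ∈ Φpos) : x ≠ 0 := ne_zero_of_mem_Φ hx.1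

theorem Φpos_asymm {x : V} (hx : x ∈ Φpos) : -x ∉ Φpos := by
  intro h
  apply ne_zero_of_mem_Φpos hx
  ext i
  have h1 := nonneg_of_mem_Φpos hx i
  have h2 := nonneg_of_mem_Φpos h i
  simp only [Pi.neg_apply] at h2
  simp only [Pi.zero_apply]
  linarith

theorem IsClosedSet.mem {R : Set V} (hR : IsClosedSet R) {x y z : V} (hx : x ∈ R) (hy : y ∈ R)
    (hz : z ∈ Φpos) {c s t : ℝ} (hc : 0 < c) (hs : 0 ≤ s) (ht : 0 ≤ t)
    (h : c • z = s • x + t • y) : z ∈ R := by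
  refine hR x hx y hy ⟨mem_nnspan_pair.2 ⟨s / c, t / c, div_nonneg hs hc.le,
    div_nonneg ht hc.le, ?_⟩, hz⟩
  have : z = c⁻¹ • (c • z) := by rw [smul_smul, inv_mul_cancel₀ hc.ne', one_smul]
  rw [this, h, smul_add, smul_smul, smul_smul, div_eq_inv_mul, div_eq_inv_mul]

theorem IsBiclosed.compl {R : Set V} (h : IsBiclosed R) : IsBiclosed (Φpos \ R) :=
  ⟨Set.sdiff_subset, h.2.2, by
    rw [Set.sdiff_sdiff_right_self, Set.inter_eq_right.2 h.1]; exact h.2.1⟩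

/-- The half system attached to a set of positive roots. -/
def halfSystemOf (R : Set V) : Set V := R ∪ {x | -x ∈ Φpos \ R}

theorem halfSystemOf_mixed {R : Set V} (hR : IsBiclosed R) {x y : V} (hx : x ∈ R)
    (hy : -y ∈ Φpos \ R) {s t : ℝ} (hs : 0 ≤ s) (ht : 0 ≤ t) (hz : s • x + t • y ∈ Φ) :
    s • x + t • y ∈ halfSystemOf R := by
  have hx0 := nonneg_of_mem_Φpos (hR.1 hx)
  have hy0 := nonneg_of_mem_Φpos hy.1
  have hz0 := ne_zero_of_mem_Φ hz
  rcases Φ_pos_or_neg hz with h | h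
  · left
    by_contra hn
    have h0 := nonneg_of_mem_Φpos h
    rcases hs.eq_or_lt with rfl | hs'
    · apply hz0
      ext i
      have h1 := h0 i
      have h2 := mul_nonneg ht (hy0 i)
      simp only [Pi.neg_apply, Pi.add_apply, Pi.smul_apply, smul_eq_mul, Pi.zero_apply] at *
      linarith
    · have : x ∈ Φpos \ R := hR.2.2.mem ⟨h, hn⟩ hy (hR.1 hx) hs' zero_le_one ht (by
        rw [one_smul, smul_neg]; abel)
      exact this.2 hx
  · right
    refine ⟨h, fun hn => ?_⟩
    have h0 := nonneg_of_mem_Φpos h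
    rcases ht.eq_or_lt with rfl | ht'
    · apply hz0
      ext i
      have h1 := h0 i
      have h2 := mul_nonneg hs (hx0 i)
      simp only [Pi.neg_apply, Pi.add_apply, Pi.smul_apply, smul_eq_mul, Pi.zero_apply] at *
      linarith
    · have : -y ∈ R := hR.2.1.mem hx hn hy.1 ht' hs zero_le_one (by
        rw [one_smul, smul_neg]; abel)
      exact hy.2 this

theorem IsBiclosed.halfSystem {R : Set V} (hR : IsBiclosed R) : HalfSystem (halfSystemOf R) where
  sub := by
    rintro x (hx | hx)
    · exact (hR.1 hx).1
    · exact neg_mem_Φ_iff.1 hx.1.1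
  total := by
    intro x hx
    by_cases h1 : x ∈ R
    · exact Or.inl (Or.inl h1)
    by_cases h2 : -x ∈ R
    · exact Or.inr (Or.inl h2)
    rcases Φ_pos_or_neg hx with h | h
    · exact Or.inr (Or.inr (by simpa using ⟨h, h1⟩))
    · exact Or.inl (Or.inr ⟨h, h2⟩)
  asymm := by
    rintro x (hx | hx) (h | h)
    · exact Φpos_asymm (hR.1 hx) (hR.1 h)
    · simp only [Set.mem_ofPred_eq, neg_neg] at h
      exact h.2 hx
    · exact hx.2 h
    · simp only [Set.mem_ofPred_eq, neg_neg] at h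
      exact Φpos_asymm h.1 hx.1
  closed := by
    rintro x (hx | hx) y (hy | hy) s t hs ht hz
    · have hpos : s • x + t • y ∈ Φpos := mem_Φpos_iff.2 ⟨hz, fun i =>
        add_nonneg (mul_nonneg hs (nonneg_of_mem_Φpos (hR.1 hx) i))
          (mul_nonneg ht (nonneg_of_mem_Φpos (hR.1 hy) i))⟩
      exact Or.inl (hR.2.1.mem hx hy hpos one_pos hs ht (one_smul _ _))
    · exact halfSystemOf_mixed hR hx hy hs ht hz
    · rw [add_comm] at hz ⊢
      exact halfSystemOf_mixed hR hy hx ht hs hz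
    · right
      have e : -(s • x + t • y) = s • (-x) + t • (-y) := by simp only [smul_neg]; abel
      have hpos : -(s • x + t • y) ∈ Φpos := mem_Φpos_iff.2 ⟨neg_mem_Φ hz, fun i => by
        rw [e]
        exact add_nonneg (mul_nonneg hs (nonneg_of_mem_Φpos hx.1 i))
          (mul_nonneg ht (nonneg_of_mem_Φpos hy.1 i))⟩
      exact hR.2.2.mem hx hy hpos one_pos hs ht (by rw [one_smul, e])

theorem edgeRoot_comm (u v : ℤ × ℤ) : edgeRoot u v = edgeRoot v u := by
  ext i; fin_cases i <;> simp [edgeRoot] <;> ring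

theorem edgeRoot_add_right (u v w : ℤ × ℤ) :
    edgeRoot u (v + w) = edgeRoot u v + edgeRoot u w := by
  ext i; fin_cases i <;> simp [edgeRoot] <;> ring

theorem edgeRoot_smul_right (k : ℤ) (u v : ℤ × ℤ) :
    edgeRoot u (k • v) = (k : ℝ) • edgeRoot u v := by
  ext i; fin_cases i <;> simp [edgeRoot] <;> ring

theorem edgeRoot_neg_right (u v : ℤ × ℤ) : edgeRoot u (-v) = -edgeRoot u v := by
  ext i; fin_cases i <;> simp [edgeRoot]; ring

theorem edgeRoot_neg_left (u v : ℤ × ℤ) : edgeRoot (-u) v = -edgeRoot u v := by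
  ext i; fin_cases i <;> simp [edgeRoot]; ring

theorem edgeRoot_lin (u v : ℤ × ℤ) (a b c d : ℤ) :
    edgeRoot (a • u + b • v) (c • u + d • v) =
      ((a * c : ℤ) : ℝ) • edgeRoot u u + ((a * d + b * c : ℤ) : ℝ) • edgeRoot u v +
        ((b * d : ℤ) : ℝ) • edgeRoot v v := by
  ext i; fin_cases i <;> simp [edgeRoot] <;> ring

theorem det2_lin (u v : ℤ × ℤ) (a b c d : ℤ) :
    det2 (a • u + b • v) (c • u + d • v) = (a * d - b * c) * det2 u v := by
  simp [det2]; ring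

theorem det2_swap (u v : ℤ × ℤ) : det2 v u = -det2 u v := by simp [det2]; ring

theorem Unimod.symm {u v : ℤ × ℤ} (h : Unimod u v) : Unimod v u := by
  simp only [Unimod, det2] at *; linear_combination h

theorem Unimod.neg_right {u v : ℤ × ℤ} (h : Unimod u v) : Unimod u (-v) := by
  simp only [Unimod, det2, Prod.fst_neg, Prod.snd_neg] at *; linear_combination h

theorem Unimod.neg_left {u v : ℤ × ℤ} (h : Unimod u v) : Unimod (-u) v :=
  h.symm.neg_right.symm

theorem Unimod.shift {u v : ℤ × ℤ} (h : Unimod u v) (k : ℤ) : Unimod u (v + k • u) := by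
  simp only [Unimod, det2, Prod.fst_add, Prod.snd_add, Prod.smul_fst, Prod.smul_snd,
    smul_eq_mul] at *
  linear_combination h

theorem Unimod.add_right {u v : ℤ × ℤ} (h : Unimod u v) : Unimod u (u + v) := by
  have := h.shift 1
  rwa [one_smul, add_comm] at this

theorem Unimod.add_left {u v : ℤ × ℤ} (h : Unimod u v) : Unimod (u + v) v := by
  have := h.symm.add_right.symm
  rwa [add_comm] at this

theorem Unimod.lin {u v : ℤ × ℤ} (h : Unimod u v) {a b c d : ℤ}
    (hd : (a * d - b * c) * (a * d - b * c) = 1) :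
    Unimod (a • u + b • v) (c • u + d • v) := by
  rw [Unimod] at *
  rw [det2_lin]
  linear_combination h * (a * d - b * c) ^ 2 + hd

theorem Unimod.expand {u v : ℤ × ℤ} (h : Unimod u v) (w : ℤ × ℤ) :
    w = (det2 u v * det2 w v) • u + (det2 u v * det2 u w) • v := by
  simp only [Unimod, det2] at h
  ext
  · simp [det2]; linear_combination -w.1 * h
  · simp [det2]; linear_combination -w.2 * h

theorem Unimod.eq_or {u v v' : ℤ × ℤ} (h : Unimod u v) (h' : Unimod u v') :
    ∃ j : ℤ, v' = v + j • u ∨ v' = -v + j • u := by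
  have e := h.expand v'
  refine ⟨det2 u v * det2 v' v, ?_⟩
  have : det2 u v * det2 u v' = 1 ∨ det2 u v * det2 u v' = -1 := by
    rw [← mul_self_eq_one_iff]
    rw [Unimod] at h h'
    linear_combination h * det2 u v' ^ 2 + h'
  rcases this with h1 | h1
  · left; rw [h1, one_smul, add_comm] at e; exact e
  · right; rw [h1, neg_one_smul, add_comm] at e; exact e

/-- The opposite set of roots. -/
def opp (P : Set V) : Set V := {x | -x ∈ P}

@[simp] theorem mem_opp {P : Set V} {x : V} : x ∈ opp P ↔ -x ∈ P := Iff.rfl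

@[simp] theorem opp_opp (P : Set V) : opp (opp P) = P := by ext; simp

theorem HalfSystem.opp {P : Set V} (hP : HalfSystem P) : HalfSystem (opp P) := hP.neg

/-- The integer vector `u` is white: along one of the two directions the roots `edgeRoot u v`
are eventually in `P`, in the sense determined by `v ↦ v + u`. -/
def Wl (P : Set V) (u : ℤ × ℤ) : Prop :=
  ∃ v, Unimod u v ∧ ∀ k : ℕ, edgeRoot u (v + (k : ℤ) • u) ∈ P

/-- The integer vector `u` is black: it is white for the opposite set of roots. -/
def Bl (P : Set V) (u : ℤ × ℤ) : Prop := Wl (opp P) u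

theorem Bl_opp {P : Set V} {u : ℤ × ℤ} : Bl (opp P) u ↔ Wl P u := by rw [Bl, opp_opp]

theorem Wl.neg {P : Set V} {u : ℤ × ℤ} (h : Wl P u) : Wl P (-u) := by
  obtain ⟨v, hv, h⟩ := h
  refine ⟨-v, hv.neg_left.neg_right, fun k => ?_⟩
  have : -v + (k : ℤ) • (-u) = -(v + (k : ℤ) • u) := by rw [smul_neg]; abel
  rw [this, edgeRoot_neg_left, edgeRoot_neg_right, neg_neg]
  exact h k

theorem Wl_neg {P : Set V} {u : ℤ × ℤ} : Wl P (-u) ↔ Wl P u :=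
  ⟨fun h => by simpa using h.neg, Wl.neg⟩

theorem Bl_neg {P : Set V} {u : ℤ × ℤ} : Bl P (-u) ↔ Bl P u := Wl_neg

theorem edgeRoot_shift (u v : ℤ × ℤ) (k : ℤ) :
    edgeRoot u (v + k • u) = edgeRoot u v + (k : ℝ) • edgeRoot u u := by
  rw [edgeRoot_add_right, edgeRoot_smul_right]

namespace HalfSystem

variable {P : Set V} (hP : HalfSystem P) {u v : ℤ × ℤ}
include hP

theorem not_mem_edge (h : Unimod u v) : edgeRoot u v ∉ P ↔ edgeRoot u v ∈ _root_.opp P :=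
  hP.not_mem_iff (edgeRoot_mem_Φ h)

theorem shift_convex (h : Unimod u v) {i j k : ℤ} (hij : i ≤ j) (hjk : j ≤ k)
    (hi : edgeRoot u (v + i • u) ∈ P) (hk : edgeRoot u (v + k • u) ∈ P) :
    edgeRoot u (v + j • u) ∈ P := by
  rcases eq_or_ne i j with rfl | hne
  · exact hi
  have h1 : (i : ℝ) < j := by exact_mod_cast lt_of_le_of_ne hij hne
  have h2 : (j : ℝ) ≤ k := by exact_mod_cast hjk
  refine hP.closed_smul hi hk (edgeRoot_mem_Φ (h.shift j)) (c := k - i) (s := k - j)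
    (t := j - i) (by linarith) (by linarith) (by linarith) ?_
  simp only [edgeRoot_shift]
  module

theorem shift_convex_compl (h : Unimod u v) {i j k : ℤ} (hij : i ≤ j) (hjk : j ≤ k)
    (hi : edgeRoot u (v + i • u) ∉ P) (hk : edgeRoot u (v + k • u) ∉ P) :
    edgeRoot u (v + j • u) ∉ P := by
  rw [hP.not_mem_edge (h.shift _)] at *
  exact hP.opp.shift_convex h hij hjk hi hk

theorem of_not_Wl (h : Unimod u v) (hu : ¬ Wl P u) :
    ∃ K : ℤ, ∀ k ≤ K, edgeRoot u (v + k • u) ∈ P := by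
  obtain ⟨k0, hk0⟩ : ∃ k0 : ℤ, edgeRoot u (v + k0 • u) ∉ P := by
    by_contra! hcon
    exact hu ⟨v, h, fun k => hcon k⟩
  obtain ⟨k1, hk1, hk1'⟩ : ∃ k1 ≤ k0, edgeRoot u (v + k1 • u) ∈ P := by
    by_contra! hcon
    refine hu ⟨-(v + k0 • u), (h.shift _).neg_right, fun k => ?_⟩
    have e : -(v + k0 • u) + (k : ℤ) • u = -(v + (k0 - k) • u) := by module
    rw [e, edgeRoot_neg_right, ← hP.not_mem_iff (edgeRoot_mem_Φ (h.shift _))]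
    exact hcon _ (by omega)
  refine ⟨k1, fun k hk => ?_⟩
  by_contra hn
  exact hP.shift_convex_compl h hk hk1 hn hk0 hk1'

theorem of_not_Bl (h : Unimod u v) (hu : ¬ Bl P u) :
    ∃ K : ℤ, ∀ k ≤ K, edgeRoot u (v + k • u) ∉ P := by
  obtain ⟨K, hK⟩ := hP.opp.of_not_Wl h hu
  exact ⟨K, fun k hk => (hP.not_mem_edge (h.shift _)).2 (hK k hk)⟩

theorem Bl_of_not_Wl (h : Unimod u v) (hu : ¬ Wl P u) : Bl P u := by
  obtain ⟨K, hK⟩ := hP.of_not_Wl h hu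
  refine ⟨-(v + K • u), (h.shift _).neg_right, fun k => ?_⟩
  have e : -(v + K • u) + (k : ℤ) • u = -(v + (K - k) • u) := by module
  rw [e, edgeRoot_neg_right, mem_opp, neg_neg]
  exact hK _ (by omega)

theorem Wl_of_not_Bl (h : Unimod u v) (hu : ¬ Bl P u) : Wl P u := by
  have := hP.opp.Bl_of_not_Wl h hu
  rwa [Bl_opp] at this

theorem of_Wl (h : Unimod u v) (hu : Wl P u) :
    ∃ K : ℤ, (∀ k ≥ K, edgeRoot u (v + k • u) ∈ P) ∨ (∀ k ≤ K, edgeRoot u (v + k • u) ∉ P) := by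
  obtain ⟨v', h', hv'⟩ := hu
  obtain ⟨j, rfl | rfl⟩ := h.eq_or h'
  · refine ⟨j, Or.inl fun k hk => ?_⟩
    have e : v + k • u = v + j • u + ((k - j).toNat : ℤ) • u := by
      rw [Int.toNat_of_nonneg (by omega)]; module
    rw [e]
    exact hv' _
  · refine ⟨-j, Or.inr fun k hk => ?_⟩
    have e : v + k • u = -(-v + j • u + ((-j - k).toNat : ℤ) • u) := by
      rw [Int.toNat_of_nonneg (by omega)]; module
    rw [e, edgeRoot_neg_right]
    exact hP.asymm _ (hv' _)

theorem not_Wl_of_two_outs (h : Unimod u v) (h1 : edgeRoot u v ∈ P)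
    (h2 : edgeRoot u (u + v) ∉ P) : ¬ Wl P u := by
  intro hw
  have h1' : edgeRoot u (v + (0 : ℤ) • u) ∈ P := by simpa using h1
  have h2' : edgeRoot u (v + (1 : ℤ) • u) ∉ P := by rwa [one_smul, add_comm]
  obtain ⟨K, hK | hK⟩ := hP.of_Wl h hw
  · exact h2' (hP.shift_convex h (k := max K 2) (by norm_num) (by omega) h1' (hK _ (by omega)))
  · exact hP.shift_convex_compl h (i := min K 0) (by omega) (by norm_num) (hK _ (by omega)) h2' h1'

theorem not_Bl_of_two_ins (h : Unimod u v) (h1 : edgeRoot u v ∉ P)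
    (h2 : edgeRoot u (u + v) ∈ P) : ¬ Bl P u :=
  hP.opp.not_Wl_of_two_outs h ((hP.not_mem_edge h).1 h1) (hP.asymm _ h2)

theorem edge_add_of_Bl (h : Unimod u v) (hu : Bl P u) (h0 : edgeRoot u v ∉ P) :
    edgeRoot u (u + v) ∉ P := fun h1 => hP.not_Bl_of_two_ins h h0 h1 hu

theorem not_Wl_add (h : Unimod u v) (hu : Bl P u) (hv : Bl P v) (h0 : edgeRoot u v ∉ P) :
    ¬ Wl P (u + v) := by
  have h1 := hP.edge_add_of_Bl h hu h0
  have h2 := hP.edge_add_of_Bl h.symm hv (by rwa [edgeRoot_comm])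
  have hx : Unimod (u + v) (-u) := by
    have := h.add_right.symm.neg_right
    exact this
  refine hP.not_Wl_of_two_outs hx ?_ ?_
  · rw [edgeRoot_comm] at h1
    rwa [edgeRoot_neg_right, ← hP.not_mem_iff (edgeRoot_mem_Φ h.add_right.symm)]
  · have e : u + v + -u = v := by abel
    rw [e, edgeRoot_comm, add_comm]
    exact h2

theorem not_Wl_of_black_cone {m n : ℕ} (hm : 1 ≤ m) (hn : 1 ≤ n) (hmn : m.Coprime n)
    (h : Unimod u v) (hu : Bl P u) (hv : Bl P v) (h0 : edgeRoot u v ∉ P) :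
    ¬ Wl P ((m : ℤ) • u + (n : ℤ) • v) := by
  induction hN : m + n using Nat.strong_induction_on generalizing m n u v with
  | _ N ih =>
  have hw := hP.not_Wl_add h hu hv h0
  have hb := hP.Bl_of_not_Wl h.add_left hw
  rcases lt_trichotomy m n with hlt | heq | hgt
  · have e : (m : ℤ) • u + (n : ℤ) • v = (m : ℤ) • (u + v) + ((n - m : ℕ) : ℤ) • v := by
      push_cast [hlt.le]; module
    rw [e]
    refine ih (m + (n - m)) (by omega) hm (by omega) ?_ h.add_left hb hv ?_ rfl
    · rwa [Nat.coprime_sub_self_right hlt.le]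
    · rw [edgeRoot_comm, add_comm]
      exact hP.edge_add_of_Bl h.symm hv (by rwa [edgeRoot_comm])
  · subst heq
    obtain rfl : m = 1 := by simpa using hmn
    simpa using hw
  · have e : (m : ℤ) • u + (n : ℤ) • v = ((m - n : ℕ) : ℤ) • u + (n : ℤ) • (u + v) := by
      push_cast [hgt.le]; module
    rw [e]
    refine ih (m - n + n) (by omega) (by omega) hn ?_ h.add_right hu hb
      (hP.edge_add_of_Bl h hu h0) rfl
    rwa [Nat.coprime_sub_self_left hgt.le]

end HalfSystem

theorem Unimod.isCoprime_coeff {u v z : ℤ × ℤ} {a c : ℤ} (h : Unimod (a • u + c • v) z) :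
    IsCoprime a c := by
  refine ⟨det2 (a • u + c • v) z * det2 u z, det2 (a • u + c • v) z * det2 v z, ?_⟩
  rw [Unimod] at h
  rw [← h]
  simp only [det2, Prod.fst_add, Prod.snd_add, Prod.smul_fst, Prod.smul_snd, smul_eq_mul]
  ring

theorem det2_eq_zero {u v w : ℤ × ℤ} (h : Unimod u v) (hw : det2 u w = 0) :
    w = (det2 u v * det2 w v) • u := by
  have := h.expand w
  rwa [hw, mul_zero, zero_smul, add_zero] at this

theorem Unimod.eq_or_neg {u v w z : ℤ × ℤ} (h : Unimod u v) (h' : Unimod w z)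
    (h0 : det2 u w = 0) : w = u ∨ w = -u := by
  have e := det2_eq_zero h h0
  set c := det2 u v * det2 w v with hc
  have hcop : IsCoprime c 0 := by
    have : Unimod (c • u + (0 : ℤ) • v) z := by rw [zero_smul, add_zero, ← e]; exact h'
    exact this.isCoprime_coeff
  have hu : IsUnit c := isCoprime_zero_right.1 hcop
  rcases Int.isUnit_iff.1 hu with h1 | h1
  · left; rw [e, h1, one_smul]
  · right; rw [e, h1, neg_one_smul]

namespace HalfSystem

variable {P : Set V} (hP : HalfSystem P) {u v : ℤ × ℤ}
include hP

theorem not_Wl_of_black (h : Unimod u v) (hu : Bl P u) (hv : Bl P v) (h0 : edgeRoot u v ∉ P)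
    {a c : ℤ} (hac : 0 < a * c) : ¬ Wl P (a • u + c • v) := by
  intro hw
  obtain ⟨z, hz, -⟩ := id hw
  have hcop := hz.isCoprime_coeff
  rcases pos_and_pos_or_neg_and_neg_of_mul_pos hac with ⟨ha, hc⟩ | ⟨ha, hc⟩
  · refine hP.not_Wl_of_black_cone (m := a.toNat) (n := c.toNat) (by omega) (by omega) ?_ h hu hv
      h0 ?_
    · rw [Nat.isCoprime_iff_coprime.symm, Int.toNat_of_nonneg ha.le, Int.toNat_of_nonneg hc.le]
      exact hcop
    · rwa [Int.toNat_of_nonneg ha.le, Int.toNat_of_nonneg hc.le]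
  · refine hP.not_Wl_of_black_cone (m := (-a).toNat) (n := (-c).toNat) (by omega) (by omega) ?_ h
      hu hv h0 ?_
    · rw [Nat.isCoprime_iff_coprime.symm, Int.toNat_of_nonneg (by omega),
        Int.toNat_of_nonneg (by omega)]
      exact hcop.neg_left.neg_right
    · rw [Int.toNat_of_nonneg (by omega), Int.toNat_of_nonneg (by omega)]
      have e : (-a) • u + (-c) • v = -(a • u + c • v) := by module
      rw [e]
      exact hw.neg

theorem arc_aux (N : ℕ) : ∀ b b' w w' : ℤ × ℤ, (det2 b b').natAbs = N → Bl P b → Bl P b' →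
    Wl P w → Wl P w' → ¬ (det2 b w * det2 b w') * (det2 b' w * det2 b' w') < 0 := by
  induction N using Nat.strong_induction_on with
  | _ N ih =>
  intro b b' w w' hN hb hb' hw hw' hlt
  obtain ⟨v₀, hv₀, -⟩ := id hb
  obtain ⟨v₀', hv₀', -⟩ := id hb'
  obtain ⟨wz, hwz, -⟩ := id hw
  obtain ⟨wz', hwz', -⟩ := id hw'
  rcases Nat.eq_zero_or_pos N with h0 | hNpos
  · rcases hv₀.eq_or_neg hv₀' (by omega) with rfl | rfl
    · exact absurd hlt (not_lt.2 (mul_self_nonneg _))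
    · simp only [det2, Prod.fst_neg, Prod.snd_neg] at hlt
      nlinarith [mul_self_nonneg ((b.1 * w.2 - b.2 * w.1) * (b.1 * w'.2 - b.2 * w'.1))]
  -- normal form `b' = s b + N v`
  obtain ⟨v, hv, s, hs0, hsN, hb'e⟩ : ∃ v, Unimod b v ∧ ∃ s : ℤ, 0 ≤ s ∧ s < N ∧
      b' = s • b + (N : ℤ) • v := by
    obtain ⟨v₁, hv₁, s₁, e₁⟩ : ∃ v₁, Unimod b v₁ ∧ ∃ s₁ : ℤ, b' = s₁ • b + (N : ℤ) • v₁ := by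
      have e := hv₀.expand b'
      have hD : (det2 b v₀ * det2 b b').natAbs = N := by
        rw [Int.natAbs_mul, hN]
        have : (det2 b v₀).natAbs = 1 := by
          rcases mul_self_eq_one_iff.1 hv₀ with h | h <;> rw [h] <;> rfl
        rw [this, one_mul]
      rcases Int.natAbs_eq (det2 b v₀ * det2 b b') with h | h
      · rw [h, hD] at e
        exact ⟨v₀, hv₀, _, e⟩
      · rw [h, hD] at e
        exact ⟨-v₀, hv₀.neg_right, _, by rw [smul_neg, ← neg_smul]; exact e⟩
    have hNz : (N : ℤ) ≠ 0 := by omega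
    refine ⟨v₁ + (s₁ / N) • b, hv₁.shift _, s₁ % N, Int.emod_nonneg _ hNz,
      Int.emod_lt_of_pos _ (by omega), ?_⟩
    rw [e₁]
    nth_rewrite 1 [← Int.emod_add_mul_ediv s₁ N]
    module
  have hD1 : (det2 b v).natAbs = 1 := by
    rcases mul_self_eq_one_iff.1 hv with h | h <;> rw [h] <;> rfl
  rcases Nat.lt_or_ge N 2 with hN1 | hN2
  · obtain rfl : N = 1 := by omega
    obtain rfl : s = 0 := by omega
    obtain rfl : b' = v := by simpa using hb'e
    have key : ∀ z, Wl P z → ∃ a c : ℤ, z = a • b + c • b' ∧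
        a * c = -(det2 b z * det2 b' z) := by
      intro z _
      refine ⟨_, _, hv.expand z, ?_⟩
      rw [Unimod] at hv
      rw [det2_swap b' z]
      linear_combination (-(det2 b z * det2 b' z)) * hv
    obtain ⟨a, c, e, hac⟩ := key w hw
    obtain ⟨a', c', e', hac'⟩ := key w' hw'
    have hneg : (a * c) * (a' * c') < 0 := by rw [hac, hac']; linarith
    by_cases hr : edgeRoot b b' ∈ P
    · have hr' : edgeRoot b (-b') ∉ P := by
        rw [edgeRoot_neg_right]; exact hP.asymm _ hr
      have hh : ∀ a c : ℤ, Wl P (a • b + c • b') → ¬ a * c < 0 := by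
        intro a c hw h
        refine hP.not_Wl_of_black hv.neg_right hb (Bl_neg.2 hb') hr' (a := a) (c := -c)
          (by linarith) ?_
        rwa [smul_neg, ← neg_smul, neg_neg]
      have h1 := hh a c (e ▸ hw)
      have h2 := hh a' c' (e' ▸ hw')
      nlinarith
    · have hh : ∀ a c : ℤ, Wl P (a • b + c • b') → ¬ 0 < a * c :=
        fun a c hw h => hP.not_Wl_of_black hv hb hb' hr h hw
      have h1 := hh a c (e ▸ hw)
      have h2 := hh a' c' (e' ▸ hw')
      nlinarith
  have hs1 : 0 < s := by
    rcases hs0.eq_or_lt with rfl | h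
    · exfalso
      rw [hb'e] at hv₀'
      have := hv₀'.isCoprime_coeff
      rw [isCoprime_zero_left, Int.isUnit_iff] at this
      omega
    · exact h
  have hwhite : ∀ p q, Unimod p q → (det2 b p).natAbs < N → (det2 b' p).natAbs < N → Wl P p := by
    intro p q hpq h1 h2
    by_contra hn
    have hbp := hP.Bl_of_not_Wl hpq hn
    have hne : ∀ z z', Unimod z z' → Wl P z → det2 p z ≠ 0 := by
      intro z z' hz hw h
      rcases hpq.eq_or_neg hz h with rfl | rfl
      · exact hn hw
      · exact hn (Wl_neg.1 hw)
    have hf : det2 p w * det2 p w' ≠ 0 := mul_ne_zero (hne w _ hwz hw) (hne w' _ hwz' hw')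
    have i1 := ih _ h1 b p w w' rfl hb hbp hw hw'
    have i2 := ih _ h2 b' p w w' rfl hb' hbp hw hw'
    generalize det2 p w * det2 p w' = X at *
    generalize det2 b w * det2 b w' = Y at *
    generalize det2 b' w * det2 b' w' = Z at *
    rcases lt_or_gt_of_ne hf with h | h
    · have : 0 ≥ Y := by nlinarith
      have : 0 ≥ Z := by nlinarith
      nlinarith
    · have : 0 ≤ Y := by nlinarith
      have : 0 ≤ Z := by nlinarith
      nlinarith
  have hx : Wl P v := by
    refine hwhite v b hv.symm (by omega) ?_
    have : det2 b' v = s * det2 b v := by rw [hb'e]; simp [det2]; ring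
    rw [this, Int.natAbs_mul, hD1]; omega
  have hy : Wl P (b + v) := by
    refine hwhite (b + v) v hv.add_left ?_ ?_
    · have : det2 b (b + v) = det2 b v := by simp [det2]; ring
      omega
    · have : det2 b' (b + v) = (s - N) * det2 b v := by rw [hb'e]; simp [det2]; ring
      rw [this, Int.natAbs_mul, hD1]; omega
  by_cases hr : edgeRoot (b + v) v ∈ P
  · refine hP.opp.not_Wl_of_black hv.add_left (Bl_opp.2 hy) (Bl_opp.2 hx) (hP.asymm _ hr)
      (a := s) (c := N - s) (mul_pos hs1 (by omega)) ?_
    have e : s • (b + v) + ((N : ℤ) - s) • v = b' := by rw [hb'e]; module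
    rw [e]; exact hb'
  · refine hP.opp.not_Wl_of_black hv.add_left.neg_right (Bl_opp.2 hy)
      (Bl_opp.2 (Wl_neg.2 hx)) ?_ (a := 1) (c := 1) (by norm_num) ?_
    · rw [edgeRoot_neg_right]
      intro h
      simp only [mem_opp, neg_neg] at h
      exact hr h
    · have e : (1 : ℤ) • (b + v) + (1 : ℤ) • (-v) = b := by module
      rw [e]; exact hb

theorem arc {b b' w w' : ℤ × ℤ} (hb : Bl P b) (hb' : Bl P b') (hw : Wl P w) (hw' : Wl P w') :
    0 ≤ (det2 b w * det2 b w') * (det2 b' w * det2 b' w') :=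
  not_lt.1 (hP.arc_aux _ b b' w w' rfl hb hb' hw hw')

end HalfSystem

theorem Unimod.exists_of_isCoprime {u v : ℤ × ℤ} (h : Unimod u v) {a c : ℤ}
    (hac : IsCoprime a c) : ∃ z, Unimod (a • u + c • v) z := by
  obtain ⟨x, y, e⟩ := hac
  refine ⟨(-y) • u + x • v, h.lin ?_⟩
  linear_combination (a * x + c * y + 1) * e

theorem Unimod.flip {u v z : ℤ × ℤ} (h : Unimod u v) {a c : ℤ}
    (hz : Unimod (a • u + c • v) z) : ∃ z', Unimod (a • u + (-c) • v) z' :=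
  h.exists_of_isCoprime hz.isCoprime_coeff.neg_right

theorem HalfSystem.compress {P : Set V} (hP : HalfSystem P) {u v z : ℤ × ℤ} (h : Unimod u v)
    (he : edgeRoot u v ∈ P) {a c : ℤ} (hac : 0 < a * c) (hz : Unimod (a • u + c • v) z)
    (h1 : ¬ Wl P (a • u + c • v)) (h2 : ¬ Bl P (a • u + (-c) • v)) : False := by
  have ez := h.expand z
  set x := det2 u v * det2 z v
  set y := det2 u v * det2 u z
  have hdet : (a * y - c * x) * (a * y - c * x) = 1 := by
    rw [Unimod, ez, det2_lin] at hz
    rw [Unimod] at h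
    linear_combination hz - (a * y - c * x) ^ 2 * h
  rw [ez] at hz
  have hz' : Unimod (a • u + (-c) • v) (x • u + (-y) • v) := h.lin (by linarith)
  obtain ⟨K, hK⟩ := hP.of_not_Wl hz h1
  obtain ⟨K', hK'⟩ := hP.of_not_Bl hz' h2
  set k : ℤ := min (min K K') (-|a * y + c * x| - 1)
  have hkneg : a * y + c * x + 2 * k * (a * c) < 0 := by
    have h3 : k ≤ -|a * y + c * x| - 1 := min_le_right _ _
    have h4 := abs_nonneg (a * y + c * x)
    have h5 := le_abs_self (a * y + c * x)
    nlinarith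
  have hf := hK k (by omega)
  have hg := hK' k (by omega)
  rw [hP.not_mem_iff (edgeRoot_mem_Φ (hz'.shift _))] at hg
  refine hP.asymm _ he (hP.closed_smul hf hg (neg_mem_Φ (edgeRoot_mem_Φ h))
    (c := (-(2 * (a * y + c * x + 2 * k * (a * c))) : ℤ)) (s := 1) (t := 1) ?_ zero_le_one
    zero_le_one ?_)
  · exact_mod_cast (by linarith : (0 : ℤ) < -(2 * (a * y + c * x + 2 * k * (a * c))))
  · ext i
    fin_cases i <;> simp [edgeRoot] <;> ring

theorem exists_lower_form {I : Set ℝ} (hI : I.Nonempty) :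
    ∃ p q : ℝ, 0 ≤ p ∧ (p ≠ 0 ∨ q ≠ 0) ∧ (∀ t, 0 < p * t + q → ∃ s ∈ I, s < t) ∧
      ∀ t, p * t + q < 0 → ∀ s ∈ I, t < s := by
  by_cases hb : BddBelow I
  · refine ⟨1, -sInf I, zero_le_one, Or.inl one_ne_zero, fun t ht => ?_, fun t ht s hs => ?_⟩
    · exact exists_lt_of_csInf_lt hI (by linarith)
    · have := csInf_le hb hs
      linarith
  · refine ⟨0, 1, le_rfl, Or.inr one_ne_zero, fun t _ => ?_, fun t ht => ?_⟩
    · rw [not_bddBelow_iff] at hb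
      exact hb t
    · norm_num at ht

theorem exists_upper_form {I : Set ℝ} (hI : I.Nonempty) :
    ∃ p q : ℝ, 0 ≤ p ∧ (p ≠ 0 ∨ q ≠ 0) ∧ (∀ t, 0 < -p * t + q → ∃ s ∈ I, t < s) ∧
      ∀ t, -p * t + q < 0 → ∀ s ∈ I, s < t := by
  obtain ⟨p, q, hp, hpq, h1, h2⟩ := exists_lower_form (I := -I) hI.neg
  refine ⟨p, q, hp, hpq, fun t ht => ?_, fun t ht s hs => ?_⟩
  · obtain ⟨s, hs, hst⟩ := h1 (-t) (by linarith)
    exact ⟨-s, hs, by linarith⟩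
  · have := h2 (-t) (by linarith) (-s) (by simpa using hs)
    linarith

/-- The real linear form with coefficients `c, d` on integer vectors. -/
def lin (c d : ℝ) (u : ℤ × ℤ) : ℝ := c * u.1 + d * u.2

theorem lin_comb (c d : ℝ) (a b : ℤ) (u v : ℤ × ℤ) :
    lin c d (a • u + b • v) = a * lin c d u + b * lin c d v := by
  simp [lin]; ring

theorem exists_lin_of_coords {b v : ℤ × ℤ} (h : Unimod b v) {p q : ℝ} (hpq : p ≠ 0 ∨ q ≠ 0) :
    ∃ c d : ℝ, (c ≠ 0 ∨ d ≠ 0) ∧ ∀ u, lin c d u =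
      p * (det2 b v * det2 u v : ℤ) + q * (det2 b v * det2 b u : ℤ) := by
  refine ⟨p * (det2 b v * v.2) - q * (det2 b v * b.2), -p * (det2 b v * v.1) +
    q * (det2 b v * b.1), ?_, ?_⟩
  · by_contra! hcon
    obtain ⟨h1, h2⟩ := hcon
    have hD : (det2 b v : ℝ) * det2 b v = 1 := by exact_mod_cast h
    have hD' : (det2 b v : ℝ) = b.1 * v.2 - b.2 * v.1 := by simp [det2]
    have hp : p = 0 := by
      linear_combination b.1 * h1 + b.2 * h2 - p * hD + p * det2 b v * hD'
    have hq : q = 0 := by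
      linear_combination v.1 * h1 + v.2 * h2 - q * hD + q * det2 b v * hD'
    rcases hpq with h | h <;> contradiction
  · intro u
    simp only [lin, Int.cast_mul]
    have e1 : (det2 u v : ℝ) = u.1 * v.2 - u.2 * v.1 := by simp [det2]
    have e2 : (det2 b u : ℝ) = b.1 * u.2 - b.2 * u.1 := by simp [det2]
    rw [e1, e2]
    ring

namespace HalfSystem

variable {P : Set V} (hP : HalfSystem P)
include hP

theorem exists_forms {b₀ v₀ w₀ z₀ : ℤ × ℤ} (hb : Unimod b₀ v₀) (hb₀ : ¬ Wl P b₀)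
    (hw : Unimod w₀ z₀) (hw₀ : ¬ Bl P w₀) :
    ∃ c₁ d₁ c₂ d₂ : ℝ, (c₁ ≠ 0 ∨ d₁ ≠ 0) ∧ (c₂ ≠ 0 ∨ d₂ ≠ 0) ∧ ∀ u z, Unimod u z →
      (0 < lin c₁ d₁ u * lin c₂ d₂ u → ¬ Bl P u) ∧
      (lin c₁ d₁ u * lin c₂ d₂ u < 0 → ¬ Wl P u) := by
  have hbb := hP.Bl_of_not_Wl hb hb₀
  have hww := hP.Wl_of_not_Bl hw hw₀
  set X : ℤ × ℤ → ℤ := fun u => det2 b₀ v₀ * det2 u v₀ with hX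
  set Y : ℤ × ℤ → ℤ := fun u => det2 b₀ v₀ * det2 b₀ u with hY
  have hY0 : ∀ u z, Unimod u z → Y u = 0 → u = b₀ ∨ u = -b₀ := by
    intro u z hu h
    refine hb.eq_or_neg hu ?_
    have := congrArg (det2 b₀ v₀ * ·) h
    simp only [hY, mul_zero] at this
    rw [Unimod] at hb
    linear_combination this - det2 b₀ u * hb
  have hYw : ∀ u, Wl P u → Y u ≠ 0 := by
    intro u hu h
    obtain ⟨z, hz, -⟩ := id hu
    rcases hY0 u z hz h with rfl | rfl
    · exact hb₀ hu
    · exact hb₀ (Wl_neg.1 hu)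
  set I : Set ℝ := {t | ∃ u, Wl P u ∧ t = (X u : ℝ) / Y u} with hI
  have hIne : I.Nonempty := ⟨_, w₀, hww, rfl⟩
  obtain ⟨p, q, hp, hpq, hp1, hp2⟩ := exists_lower_form hIne
  obtain ⟨p', q', hp', hpq', hp1', hp2'⟩ := exists_upper_form hIne
  obtain ⟨c₁, d₁, hc1, e1⟩ := exists_lin_of_coords hb hpq
  obtain ⟨c₂, d₂, hc2, e2⟩ := exists_lin_of_coords hb
    (p := -p') (q := q') (hpq'.imp neg_ne_zero.2 id)
  refine ⟨c₁, d₁, c₂, d₂, hc1, hc2, fun u z hu => ?_⟩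
  have e1u : lin c₁ d₁ u = p * X u + q * Y u := e1 u
  have e2u : lin c₂ d₂ u = -p' * X u + q' * Y u := e2 u
  by_cases hy : Y u = 0
  · have hnp : lin c₁ d₁ u * lin c₂ d₂ u ≤ 0 := by
      rw [e1u, e2u, hy]
      simp only [Int.cast_zero, mul_zero, add_zero]
      nlinarith [mul_nonneg (mul_nonneg hp hp') (sq_nonneg (X u : ℝ))]
    refine ⟨fun h => absurd h (not_lt.2 hnp), fun _ hw => hYw u hw hy⟩
  · have hyR : (Y u : ℝ) ≠ 0 := by exact_mod_cast hy
    have hysq : 0 < (Y u : ℝ) ^ 2 := by positivity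
    set t : ℝ := X u / Y u with ht
    have hXt : (X u : ℝ) = t * Y u := by rw [ht]; field_simp
    have hφ : lin c₁ d₁ u * lin c₂ d₂ u = (Y u : ℝ) ^ 2 * ((p * t + q) * (-p' * t + q')) := by
      rw [e1u, e2u, hXt]; ring
    rw [hφ]
    constructor
    · intro hpos hbl
      have hpos' := (mul_pos_iff_of_pos_left hysq).1 hpos
      rcases pos_and_pos_or_neg_and_neg_of_mul_pos hpos' with ⟨h1, h2⟩ | ⟨h1, h2⟩
      · obtain ⟨_, ⟨w, hw1, rfl⟩, hs⟩ := hp1 t h1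
        obtain ⟨_, ⟨w', hw1', rfl⟩, hs'⟩ := hp1' t h2
        have harc := hP.arc hbb hbl hw1 hw1'
        have hYw1 : (Y w : ℝ) ≠ 0 := by exact_mod_cast hYw w hw1
        have hYw2 : (Y w' : ℝ) ≠ 0 := by exact_mod_cast hYw w' hw1'
        have hdet : ∀ x : ℤ × ℤ, (Y x : ℝ) ≠ 0 →
            (det2 b₀ x : ℝ) * det2 u x = Y x ^ 2 * Y u * (t - X x / Y x) := by
          intro x hx
          have : det2 b₀ x * det2 u x = Y x * (X u * Y x - Y u * X x) := by
            simp only [hX, hY]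
            rw [Unimod] at hb
            have hu' := hb
            simp only [det2] at hu' ⊢
            linear_combination (-((b₀.1 * x.2 - b₀.2 * x.1) * (u.1 * x.2 - u.2 * x.1)) *
              ((b₀.1 * v₀.2 - b₀.2 * v₀.1) ^ 2 + 1)) * hu'
          have hR : (det2 b₀ x : ℝ) * det2 u x = Y x * (X u * Y x - Y u * X x) := by
            exact_mod_cast this
          rw [hR, hXt]
          field_simp
        have harcR : (0 : ℝ) ≤ (det2 b₀ w * det2 u w) * (det2 b₀ w' * det2 u w') := by
          have : (0 : ℤ) ≤ (det2 b₀ w * det2 u w) * (det2 b₀ w' * det2 u w') := by linarith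
          exact_mod_cast this
        rw [hdet w hYw1, hdet w' hYw2] at harcR
        have h3 : 0 < t - X w / Y w := by linarith
        have h4 : 0 < X w' / Y w' - t := by linarith
        have h5 : 0 < (Y w : ℝ) ^ 2 := by positivity
        have h6 : 0 < (Y w' : ℝ) ^ 2 := by positivity
        have := mul_pos (mul_pos (mul_pos h5 h6) hysq) (mul_pos h3 h4)
        nlinarith
      · obtain ⟨s, hs⟩ := hIne
        have := hp2 t h1 s hs
        have := hp2' t h2 s hs
        linarith
    · intro hneg hwl
      have hmem : t ∈ I := ⟨u, hwl, rfl⟩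
      have hneg' : (p * t + q) * (-p' * t + q') < 0 := by
        by_contra hcon
        exact absurd hneg (not_lt.2 (mul_nonneg hysq.le (not_lt.1 hcon)))
      rcases mul_neg_iff.1 hneg' with ⟨_, h⟩ | ⟨h, _⟩
      · exact lt_irrefl _ (hp2' t h t hmem)
      · exact lt_irrefl _ (hp2 t h t hmem)

end HalfSystem

theorem four_mul_ge_sq {p q T : ℝ} (hT : 0 < T)
    (H : ∀ a b : ℤ, 0 < a → 0 < b → T * (a * b) ≤ |(a : ℝ) ^ 2 * p + (b : ℝ) ^ 2 * q|) :
    T ^ 2 ≤ 4 * (p * q) := by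
  have HQ : ∀ τ : ℚ, 0 < τ → T * τ ≤ |p + (τ : ℝ) ^ 2 * q| := by
    intro τ hτ
    have h := H τ.den τ.num (by exact_mod_cast τ.den_pos) (Rat.num_pos.2 hτ)
    have hd : (0 : ℝ) < τ.den := by exact_mod_cast τ.den_pos
    have hn : (τ.num : ℝ) = τ * τ.den := by exact_mod_cast (Rat.mul_den_eq_num τ).symm
    have hd' : ((τ.den : ℤ) : ℝ) = τ.den := by simp
    rw [hn, hd'] at h
    have e : (τ.den : ℝ) ^ 2 * p + (τ * τ.den : ℝ) ^ 2 * q =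
        (τ.den : ℝ) ^ 2 * (p + (τ : ℝ) ^ 2 * q) := by ring
    rw [e, abs_mul, abs_of_pos (by positivity : (0 : ℝ) < (τ.den : ℝ) ^ 2)] at h
    have hpos : (0 : ℝ) < (τ.den : ℝ) ^ 2 := by positivity
    refine le_of_mul_le_mul_left ?_ hpos
    linarith
  have HR : ∀ τ : ℝ, 0 < τ → T * τ ≤ |p + τ ^ 2 * q| := by
    intro τ hτ
    by_contra! hlt
    have hopen : IsOpen {x : ℝ | 0 < x ∧ |p + x ^ 2 * q| < T * x} :=
      (isOpen_lt continuous_const continuous_id).and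
        (isOpen_lt (f := fun x : ℝ => |p + x ^ 2 * q|) (g := fun x => T * x)
          (by fun_prop) (by fun_prop))
    obtain ⟨r, hr1, hr2⟩ := Rat.denseRange_cast.exists_mem_open hopen ⟨τ, hτ, hlt⟩
    exact absurd (HQ r (by exact_mod_cast hr1)) (not_le.2 hr2)
  rcases eq_or_ne q 0 with rfl | hq
  · exfalso
    have h := HR (|p| / T + 1) (by positivity)
    rw [mul_zero, add_zero, mul_add, mul_div_cancel₀ _ hT.ne'] at h
    linarith
  rcases eq_or_ne p 0 with rfl | hp
  · exfalso
    have hq' : 0 < |q| := abs_pos.2 hq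
    have h := HR (T / (2 * |q|)) (by positivity)
    rw [zero_add, abs_mul, abs_of_nonneg (sq_nonneg (T / (2 * |q|)))] at h
    have e1 : T * (T / (2 * |q|)) = 2 * (T ^ 2 / (4 * |q|)) := by field_simp; norm_num
    have e2 : (T / (2 * |q|)) ^ 2 * |q| = T ^ 2 / (4 * |q|) := by field_simp; norm_num
    rw [e1, e2] at h
    have : 0 < T ^ 2 / (4 * |q|) := by positivity
    linarith
  rcases lt_or_gt_of_ne (mul_ne_zero hp hq) with hneg | hpos
  · exfalso
    have hr : 0 < -p / q := by
      have : -p / q = -(p * q) / q ^ 2 := by field_simp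
      rw [this]
      exact div_pos (by linarith) (by positivity)
    have h := HR (√(-p / q)) (Real.sqrt_pos.2 hr)
    rw [Real.sq_sqrt hr.le, div_mul_cancel₀ _ hq, add_neg_cancel, abs_zero] at h
    exact absurd h (not_le.2 (mul_pos hT (Real.sqrt_pos.2 hr)))
  · have hr : 0 < p / q := by
      have : p / q = (p * q) / q ^ 2 := by field_simp
      rw [this]
      positivity
    have h := HR (√(p / q)) (Real.sqrt_pos.2 hr)
    rw [Real.sq_sqrt hr.le, div_mul_cancel₀ _ hq] at h
    have h2 := mul_self_le_mul_self (by positivity) h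
    rw [abs_mul_abs_self] at h2
    have e : T * √(p / q) * (T * √(p / q)) = T ^ 2 * (p / q) := by
      rw [show T * √(p / q) * (T * √(p / q)) = T ^ 2 * (√(p / q)) ^ 2 by ring, Real.sq_sqrt hr.le]
    rw [e] at h2
    have hpq : p = p / q * q := (div_mul_cancel₀ _ hq).symm
    set r := p / q
    refine le_of_mul_le_mul_left ?_ hr
    calc r * T ^ 2 = T ^ 2 * r := mul_comm _ _
      _ ≤ (p + p) * (p + p) := h2
      _ = r * (4 * (p * q)) := by rw [hpq]; ring


theorem HalfSystem.exists_nonneg_of_mixed {P : Set V} (hP : HalfSystem P) {b₀ v₀ w₀ z₀ : ℤ × ℤ}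
    (hb : Unimod b₀ v₀) (hb₀ : ¬ Wl P b₀) (hw : Unimod w₀ z₀) (hw₀ : ¬ Bl P w₀) :
    ∃ c₁ d₁ c₂ d₂ : ℝ, (c₁ ≠ 0 ∨ d₁ ≠ 0) ∧ (c₂ ≠ 0 ∨ d₂ ≠ 0) ∧
      ∀ u v, Unimod u v → edgeRoot u v ∈ P →
        0 ≤ lin c₁ d₁ u * lin c₂ d₂ v + lin c₁ d₁ v * lin c₂ d₂ u := by
  obtain ⟨c₁, d₁, c₂, d₂, h1, h2, hφ⟩ := hP.exists_forms hb hb₀ hw hw₀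
  refine ⟨c₁, d₁, c₂, d₂, h1, h2, fun u v h he => ?_⟩
  by_contra! hneg
  have E1 := fun a b : ℤ => lin_comb c₁ d₁ a b u v
  have E2 := fun a b : ℤ => lin_comb c₂ d₂ a b u v
  have hbb := hP.Bl_of_not_Wl hb hb₀
  have hww := hP.Wl_of_not_Bl hw hw₀
  set a₁ := lin c₁ d₁ u
  set a₂ := lin c₁ d₁ v
  set b₁ := lin c₂ d₂ u
  set b₂ := lin c₂ d₂ v
  have hcop : ∀ a b : ℤ, 0 < a → 0 < b → IsCoprime a b →
      -(a₁ * b₂ + a₂ * b₁) * (a * b) ≤ |(a : ℝ) ^ 2 * (a₁ * b₁) + (b : ℝ) ^ 2 * (a₂ * b₂)| := by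
    intro a b ha hb hab
    by_contra! hlt
    rw [abs_lt] at hlt
    obtain ⟨z, hz⟩ := h.exists_of_isCoprime hab
    obtain ⟨z', hz'⟩ := h.exists_of_isCoprime hab.neg_right
    refine hP.compress h he (mul_pos ha hb) hz ((hφ _ z hz).2 ?_) ((hφ _ z' hz').1 ?_)
    · rw [E1, E2]; linarith
    · rw [E1, E2]; push_cast; linarith
  have hall : ∀ a b : ℤ, 0 < a → 0 < b →
      -(a₁ * b₂ + a₂ * b₁) * (a * b) ≤ |(a : ℝ) ^ 2 * (a₁ * b₁) + (b : ℝ) ^ 2 * (a₂ * b₂)| := by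
    intro a b ha hb
    obtain ⟨a', b', hg, ea, eb⟩ := Int.exists_gcd_one (Int.gcd_pos_of_ne_zero_left b ha.ne')
    have hgpos : (0 : ℤ) < (Int.gcd a b : ℤ) := by
      exact_mod_cast Int.gcd_pos_of_ne_zero_left b ha.ne'
    generalize (Int.gcd a b : ℤ) = g at *
    subst ea eb
    have := hcop a' b' (pos_of_mul_pos_left ha hgpos.le) (pos_of_mul_pos_left hb hgpos.le)
      (Int.isCoprime_iff_gcd_eq_one.2 hg)
    have hgR : (0 : ℝ) < (g : ℝ) ^ 2 := by
      have : (0 : ℝ) < g := by exact_mod_cast hgpos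
      positivity
    have e : ((a' * g : ℤ) : ℝ) ^ 2 * (a₁ * b₁) + ((b' * g : ℤ) : ℝ) ^ 2 * (a₂ * b₂) =
        (g : ℝ) ^ 2 * ((a' : ℝ) ^ 2 * (a₁ * b₁) + (b' : ℝ) ^ 2 * (a₂ * b₂)) := by
      push_cast; ring
    rw [e, abs_mul, abs_of_pos hgR]
    have := mul_le_mul_of_nonneg_left this hgR.le
    push_cast
    linarith
  have h4 := four_mul_ge_sq (neg_pos.2 hneg) hall
  have heq : a₁ * b₂ = a₂ * b₁ := by
    have : (a₁ * b₂ - a₂ * b₁) ^ 2 ≤ 0 := by linarith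
    exact sub_eq_zero.1 (pow_eq_zero_iff two_ne_zero |>.1 (le_antisymm this (sq_nonneg _)))
  have ha1 : a₁ ≠ 0 := by rintro h0; rw [h0] at heq hneg; linarith
  have ha2 : a₂ ≠ 0 := by rintro h0; rw [h0] at heq hneg; linarith
  have hb1 : b₁ ≠ 0 := by rintro h0; rw [h0] at heq hneg; linarith
  set κ := b₁ / a₁ with hκ
  have eb1 : b₁ = κ * a₁ := by rw [hκ]; field_simp
  have eb2 : b₂ = κ * a₂ := by
    rw [hκ]; field_simp; linarith
  have hκ0 : κ ≠ 0 := div_ne_zero hb1 ha1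
  have hprod : κ * (a₁ * a₂) < 0 := by rw [eb1, eb2] at hneg; linarith
  have hform : ∀ a b : ℤ, lin c₁ d₁ (a • u + b • v) * lin c₂ d₂ (a • u + b • v) =
      κ * (a * a₁ + b * a₂) ^ 2 := by
    intro a b
    rw [E1, E2, eb1, eb2]; ring
  have hzero : ∀ a b : ℤ, (a * a₁ + b * a₂ : ℝ) ^ 2 ≤ 0 → (a : ℝ) * a₁ = -(b * a₂) := by
    intro a b hab
    have := pow_eq_zero_iff two_ne_zero |>.1 (le_antisymm hab (sq_nonneg _))
    linarith
  have hne : ∀ (a b : ℤ) z, Unimod (a • u + b • v) z → (a : ℝ) * a₁ = -(b * a₂) → b ≠ 0 := by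
    rintro a b z hz hab rfl
    have ha : a = 0 := by simpa [ha1] using hab
    subst ha
    have := hz.isCoprime_coeff
    exact not_isCoprime_zero_zero this
  rcases lt_or_gt_of_ne hκ0 with hk | hk
  · have e := h.expand w₀
    set a := det2 u v * det2 w₀ v
    set b := det2 u v * det2 u w₀
    have hnn := not_lt.1 fun hlt => (hφ w₀ z₀ hw).2 hlt hww
    rw [e] at hw hnn hw₀
    rw [hform] at hnn
    have hz := hzero a b (by nlinarith [sq_nonneg (a * a₁ + b * a₂ : ℝ)])
    have hbne := hne a b _ hw hz
    have hbR : (0 : ℝ) < (b * a₂) ^ 2 := by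
      have : (b : ℝ) ≠ 0 := by exact_mod_cast hbne
      positivity
    have hpos : 0 < a₁ * a₂ := by nlinarith
    have hab : a * b < 0 := by
      have : ((a * b : ℤ) : ℝ) * (a₁ * a₂) = -(b * a₂) ^ 2 := by
        push_cast; linear_combination b * a₂ * hz
      have : ((a * b : ℤ) : ℝ) < 0 := by nlinarith
      exact_mod_cast this
    obtain ⟨z', hz'⟩ := h.flip hw
    refine hP.compress h he (a := a) (c := -b) (by linarith) hz' ((hφ _ z' hz').2 ?_) ?_
    · rw [hform]
      have : (a * a₁ + (-b : ℤ) * a₂ : ℝ) ^ 2 = 4 * (b * a₂) ^ 2 := by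
        push_cast; rw [hz]; ring
      rw [this]
      exact mul_neg_of_neg_of_pos hk (by linarith)
    · rwa [neg_neg]
  · have e := h.expand b₀
    set a := det2 u v * det2 b₀ v
    set b := det2 u v * det2 u b₀
    have hnp := not_lt.1 fun hlt => (hφ b₀ v₀ hb).1 hlt hbb
    rw [e] at hb hnp hb₀
    rw [hform] at hnp
    have hz := hzero a b (by nlinarith [sq_nonneg (a * a₁ + b * a₂ : ℝ)])
    have hbne := hne a b _ hb hz
    have hbR : (0 : ℝ) < (b * a₂) ^ 2 := by
      have : (b : ℝ) ≠ 0 := by exact_mod_cast hbne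
      positivity
    have hneg' : a₁ * a₂ < 0 := by nlinarith
    have hab : 0 < a * b := by
      have : ((a * b : ℤ) : ℝ) * (a₁ * a₂) = -(b * a₂) ^ 2 := by
        push_cast; linear_combination b * a₂ * hz
      have : (0 : ℝ) < ((a * b : ℤ) : ℝ) := by nlinarith
      exact_mod_cast this
    obtain ⟨z', hz'⟩ := h.flip hb
    refine hP.compress h he (a := a) (c := b) hab hb hb₀ ((hφ _ z' hz').1 ?_)
    rw [hform]
    have : (a * a₁ + (-b : ℤ) * a₂ : ℝ) ^ 2 = 4 * (b * a₂) ^ 2 := by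
      push_cast; rw [hz]; ring
    rw [this]
    exact mul_pos hk (by linarith)

/-- The functional on `V` inducing the form `A w₁z₁ + C w₂z₂ + D (w₁z₂ + w₂z₁)` on edge roots. -/
def formVec (A C D : ℝ) : V := ![D, A - D, C - D]

/-- The standard dot product on `V`. -/
def dot (n x : V) : ℝ := n 0 * x 0 + n 1 * x 1 + n 2 * x 2

theorem dot_formVec (A C D : ℝ) (w z : ℤ × ℤ) :
    dot (formVec A C D) (edgeRoot w z) =
      A * (w.1 * z.1) + C * (w.2 * z.2) + D * (w.1 * z.2 + w.2 * z.1) := by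
  simp [dot, formVec, edgeRoot]; ring

theorem formVec_eq_zero {A C D : ℝ} (h : formVec A C D = 0) : A = 0 ∧ C = 0 ∧ D = 0 := by
  have h0 := congrFun h 0
  have h1 := congrFun h 1
  have h2 := congrFun h 2
  simp [formVec] at h0 h1 h2
  exact ⟨by linarith, by linarith, h0⟩

theorem dot_neg_right (n x : V) : dot n (-x) = -dot n x := by simp [dot]; ring

theorem dot_neg_left (n x : V) : dot (-n) x = -dot n x := by simp [dot]; ring

/-- The functional sending `edgeRoot (a u + b v) (a' u + b' v)` to `a a' + b b'`. -/
def diagVec (u v : ℤ × ℤ) : V :=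
  formVec ((u.2 ^ 2 + v.2 ^ 2 : ℤ) : ℝ) ((u.1 ^ 2 + v.1 ^ 2 : ℤ) : ℝ)
    ((-(u.1 * u.2 + v.1 * v.2) : ℤ) : ℝ)

theorem dot_diagVec {u v : ℤ × ℤ} (h : Unimod u v) (a b a' b' : ℤ) :
    dot (diagVec u v) (edgeRoot (a • u + b • v) (a' • u + b' • v)) =
      ((a * a' + b * b' : ℤ) : ℝ) := by
  rw [diagVec, dot_formVec]
  simp only [Prod.fst_add, Prod.snd_add, Prod.smul_fst, Prod.smul_snd, smul_eq_mul]
  norm_cast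
  simp only [Unimod, det2] at h
  linear_combination (a * a' + b * b') * h

theorem diagVec_ne_zero {u v : ℤ × ℤ} (h : Unimod u v) : diagVec u v ≠ 0 := by
  intro h0
  have := dot_diagVec h 1 0 1 0
  rw [h0] at this
  simp [dot] at this

theorem exists_sign_normal_form {a b a' b' : ℤ}
    (hd : (a * b' - b * a') * (a * b' - b * a') = 1) (hneg : a * a' + b * b' < 0) :
    ∃ m n m' n' : ℕ, ∃ σ : ℤ, (σ = 1 ∨ σ = -1) ∧
      ((m * n' - n * m' : ℤ) * (m * n' - n * m') = 1) ∧ a * a' = -(m * m') ∧ b * b' = -(n * n') ∧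
      a * b' = -(σ * (m * n')) ∧ b * a' = -(σ * (n * m')) := by
  have hprod : 0 ≤ (a * b') * (b * a') := by
    generalize a * b' = x at *
    generalize b * a' = y at *
    by_contra! hlt
    have hle : x * y ≤ -1 := by omega
    nlinarith [sq_nonneg (x + y)]
  have hprod' : 0 ≤ (a * a') * (b * b') := by linarith
  have haa : a * a' ≤ 0 := by
    by_contra! h
    nlinarith
  have hbb : b * b' ≤ 0 := by
    by_contra! h
    nlinarith
  have e1 : (a.natAbs : ℤ) * a'.natAbs = -(a * a') := by
    rw [← Int.natCast_mul, ← Int.natAbs_mul]; omega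
  have e2 : (b.natAbs : ℤ) * b'.natAbs = -(b * b') := by
    rw [← Int.natCast_mul, ← Int.natAbs_mul]; omega
  have e3 : (a.natAbs : ℤ) * b'.natAbs = |a * b'| := by
    rw [abs_mul, Int.abs_eq_natAbs, Int.abs_eq_natAbs]
  have e4 : (b.natAbs : ℤ) * a'.natAbs = |b * a'| := by
    rw [abs_mul, Int.abs_eq_natAbs, Int.abs_eq_natAbs]
  refine ⟨a.natAbs, b.natAbs, a'.natAbs, b'.natAbs, ?_⟩
  rw [e1, e2, e3, e4]
  have hsame : (0 ≤ a * b' ∧ 0 ≤ b * a') ∨ (a * b' ≤ 0 ∧ b * a' ≤ 0) := by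
    generalize a * b' = x at *
    generalize b * a' = y at *
    rcases lt_trichotomy x 0 with hx | hx | hx
    · right; exact ⟨hx.le, by nlinarith⟩
    · rcases le_total 0 y with hy | hy
      · left; exact ⟨hx.ge, hy⟩
      · right; exact ⟨hx.le, hy⟩
    · left; exact ⟨hx.le, by nlinarith⟩
  rcases hsame with ⟨h1, h2⟩ | ⟨h1, h2⟩
  · refine ⟨-1, Or.inr rfl, ?_, by ring, by ring, ?_, ?_⟩
    · rw [abs_of_nonneg h1, abs_of_nonneg h2]; exact hd
    · rw [abs_of_nonneg h1]; ring
    · rw [abs_of_nonneg h2]; ring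
  · refine ⟨1, Or.inl rfl, ?_, by ring, by ring, ?_, ?_⟩
    · rw [abs_of_nonpos h1, abs_of_nonpos h2]; linarith
    · rw [abs_of_nonpos h1]; ring
    · rw [abs_of_nonpos h2]; ring

theorem exists_normal_form {u v : ℤ × ℤ} (h : Unimod u v) {x : V} (hx : x ∈ Φ)
    (hneg : dot (diagVec u v) x < 0) :
    ∃ m n m' n' : ℕ, ∃ σ : ℤ, (σ = 1 ∨ σ = -1) ∧
      ((m * n' - n * m' : ℤ) * (m * n' - n * m') = 1) ∧
      x = -edgeRoot ((m : ℤ) • u + (σ * n) • v) ((m' : ℤ) • u + (σ * n') • v) := by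
  obtain ⟨w, z, hwz, rfl⟩ := mem_Φ_iff.1 hx
  have ew := h.expand w
  have ez := h.expand z
  generalize det2 u v * det2 w v = a at ew
  generalize det2 u v * det2 u w = b at ew
  generalize det2 u v * det2 z v = a' at ez
  generalize det2 u v * det2 u z = b' at ez
  subst ew ez
  rw [dot_diagVec h] at hneg
  have hd : (a * b' - b * a') * (a * b' - b * a') = 1 := by
    rw [Unimod, det2_lin] at hwz
    rw [Unimod] at h
    linear_combination hwz - (a * b' - b * a') ^ 2 * h
  obtain ⟨m, n, m', n', σ, hσ, hd', h1, h2, h3, h4⟩ :=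
    exists_sign_normal_form hd (by exact_mod_cast hneg)
  refine ⟨m, n, m', n', σ, hσ, hd', ?_⟩
  have hσ2 : σ * n * (σ * n') = n * n' := by rcases hσ with rfl | rfl <;> ring
  rw [edgeRoot_lin, edgeRoot_lin, h1, h2, h3, h4, hσ2]
  push_cast
  module

namespace HalfSystem

variable {P : Set V} (hP : HalfSystem P)

theorem edge_nat_lin (H : ∀ u v, Unimod u v → edgeRoot u v ∈ P → edgeRoot u (u + v) ∈ P)
    (N : ℕ) : ∀ (u v : ℤ × ℤ) (m n m' n' : ℕ), m + n + m' + n' = N → Unimod u v →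
      edgeRoot u v ∈ P → (m * n' - n * m' : ℤ) * (m * n' - n * m') = 1 →
      edgeRoot ((m : ℤ) • u + (n : ℤ) • v) ((m' : ℤ) • u + (n' : ℤ) • v) ∈ P := by
  induction N using Nat.strong_induction_on with
  | _ N ih =>
  intro u v m n m' n' hN h he hd
  by_cases h1 : n ≤ m ∧ n' ≤ m'
  · obtain ⟨h1, h2⟩ := h1
    have hpos : 0 < n + n' := by
      by_contra hcon
      obtain rfl : n = 0 := by omega
      obtain rfl : n' = 0 := by omega
      simp at hd
    have := ih _ (by omega) u (u + v) (m - n) n (m' - n') n' rfl h.add_right (H u v h he) (by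
      push_cast [h1, h2]; linarith)
    convert this using 2
    · push_cast [h1]; module
    · push_cast [h2]; module
  by_cases h2 : m ≤ n ∧ m' ≤ n'
  · obtain ⟨h1, h2⟩ := h2
    have hpos : 0 < m + m' := by
      by_contra hcon
      obtain rfl : m = 0 := by omega
      obtain rfl : m' = 0 := by omega
      simp at hd
    have he' : edgeRoot (u + v) v ∈ P := by
      rw [edgeRoot_comm, add_comm]
      exact H v u h.symm (by rwa [edgeRoot_comm])
    have := ih _ (by omega) (u + v) v m (n - m) m' (n' - m') rfl h.add_left he' (by
      push_cast [h1, h2]; linarith)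
    convert this using 2
    · push_cast [h1]; module
    · push_cast [h2]; module
  have hcase : (n < m ∧ m' < n') ∨ (m < n ∧ n' < m') := by omega
  rcases hcase with ⟨h3, h4⟩ | ⟨h3, h4⟩
  · have h5 : ((m * n' - n * m' : ℤ)) = 1 := by
      rcases mul_self_eq_one_iff.1 hd with h | h
      · exact h
      · zify at h3 h4
        nlinarith [mul_nonneg (sub_nonneg.2 (Int.add_one_le_of_lt h3))
          (sub_nonneg.2 (Int.add_one_le_of_lt h4))]
    have h6 : n = 0 ∧ m' = 0 ∧ m = 1 ∧ n' = 1 := by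
      zify at h3 h4
      have h7 : (n : ℤ) + m' ≤ 0 := by
        nlinarith [mul_nonneg (sub_nonneg.2 (Int.add_one_le_of_lt h3))
          (sub_nonneg.2 (Int.add_one_le_of_lt h4))]
      obtain rfl : n = 0 := by omega
      obtain rfl : m' = 0 := by omega
      simp only [Nat.cast_zero, zero_mul, sub_zero] at h5
      have h8 : m * n' = 1 := by exact_mod_cast h5
      exact ⟨rfl, rfl, Nat.eq_one_of_mul_eq_one_right h8, Nat.eq_one_of_mul_eq_one_left h8⟩
    obtain ⟨rfl, rfl, rfl, rfl⟩ := h6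
    simpa using he
  · have h5 : ((m * n' - n * m' : ℤ)) = -1 := by
      rcases mul_self_eq_one_iff.1 hd with h | h
      · zify at h3 h4
        nlinarith [mul_nonneg (sub_nonneg.2 (Int.add_one_le_of_lt h3))
          (sub_nonneg.2 (Int.add_one_le_of_lt h4))]
      · exact h
    have h6 : m = 0 ∧ n' = 0 ∧ n = 1 ∧ m' = 1 := by
      zify at h3 h4
      have h7 : (m : ℤ) + n' ≤ 0 := by
        nlinarith [mul_nonneg (sub_nonneg.2 (Int.add_one_le_of_lt h3))
          (sub_nonneg.2 (Int.add_one_le_of_lt h4))]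
      obtain rfl : m = 0 := by omega
      obtain rfl : n' = 0 := by omega
      simp only [Nat.cast_zero, zero_mul, zero_sub, neg_inj] at h5
      have h8 : n * m' = 1 := by exact_mod_cast h5
      exact ⟨rfl, rfl, Nat.eq_one_of_mul_eq_one_right h8, Nat.eq_one_of_mul_eq_one_left h8⟩
    obtain ⟨rfl, rfl, rfl, rfl⟩ := h6
    simpa [edgeRoot_comm v u] using he

include hP

theorem normal_form_of_mem (H : ∀ u v, Unimod u v → edgeRoot u v ∈ P → edgeRoot u (u + v) ∈ P)
    {u v : ℤ × ℤ} (h : Unimod u v) (he : edgeRoot u v ∈ P) {x : V} (hx : x ∈ P)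
    (hneg : dot (diagVec u v) x < 0) :
    ∃ m n m' n' : ℕ, ((m * n' - n * m' : ℤ) * (m * n' - n * m') = 1) ∧
      x = edgeRoot ((m : ℤ) • u + (-n : ℤ) • v) ((-m' : ℤ) • u + (n' : ℤ) • v) := by
  obtain ⟨m, n, m', n', σ, rfl | rfl, hd, hx'⟩ := exists_normal_form h (hP.sub hx) hneg
  · exfalso
    rw [one_mul, one_mul] at hx'
    have := edge_nat_lin H _ u v m n m' n' rfl h he hd
    exact hP.asymm _ this (hx' ▸ hx)
  · refine ⟨m, n, m', n', hd, ?_⟩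
    rw [hx', ← edgeRoot_neg_right]
    congr 1
    · module
    · module

theorem exists_diagVec (H : ∀ u v, Unimod u v → edgeRoot u v ∈ P → edgeRoot u (u + v) ∈ P)
    (F : Finset V) (hF : ∀ x ∈ F, x ∈ P) :
    ∃ u v, Unimod u v ∧ edgeRoot u v ∈ P ∧ ∀ x ∈ F, 0 ≤ dot (diagVec u v) x := by
  classical
  induction F using Finset.induction_on with
  | empty =>
    obtain ⟨u, v, h, e⟩ := α_eq_edgeRoot 0
    rcases hP.total (edgeRoot u v) (edgeRoot_mem_Φ h) with h' | h'
    · exact ⟨u, v, h, h', by simp⟩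
    · exact ⟨u, -v, h.neg_right, by rwa [edgeRoot_neg_right], by simp⟩
  | insert q F _ ih =>
    obtain ⟨u, v, h, he, hpos⟩ := ih fun x hx => hF x (Finset.mem_insert_of_mem hx)
    have hq := hF q (Finset.mem_insert_self _ _)
    rcases le_or_gt 0 (dot (diagVec u v) q) with h0 | h0
    · refine ⟨u, v, h, he, fun x hx => ?_⟩
      rcases Finset.mem_insert.1 hx with rfl | hx
      · exact h0
      · exact hpos x hx
    · obtain ⟨m, n, m', n', hd, rfl⟩ := hP.normal_form_of_mem H h he hq h0
      rw [dot_diagVec h] at h0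
      have hmm : (0 : ℤ) < m * m' + n * n' := by
        have : (m : ℤ) * -m' + -n * n' < 0 := by exact_mod_cast h0
        linarith
      have hwz : Unimod ((m : ℤ) • u + (-n : ℤ) • v) ((-m' : ℤ) • u + (n' : ℤ) • v) :=
        h.lin (by linarith)
      refine ⟨_, _, hwz, hq, fun x hx => ?_⟩
      rcases Finset.mem_insert.1 hx with rfl | hxF
      · have := dot_diagVec hwz 1 0 0 1
        simp only [one_smul, zero_smul, add_zero, zero_add] at this
        rw [this]
        norm_num
      · by_contra! hneg
        obtain ⟨k, l, k', l', hd', rfl⟩ := hP.normal_form_of_mem H hwz hq (hF _ hx) hneg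
        have h1 := hpos _ hxF
        have ea : (k : ℤ) • ((m : ℤ) • u + (-n : ℤ) • v) +
            (-l : ℤ) • ((-m' : ℤ) • u + (n' : ℤ) • v) =
            (k * m + l * m' : ℤ) • u + (-(k * n + l * n') : ℤ) • v := by module
        have eb : (-k' : ℤ) • ((m : ℤ) • u + (-n : ℤ) • v) +
            (l' : ℤ) • ((-m' : ℤ) • u + (n' : ℤ) • v) =
            (-(k' * m + l' * m') : ℤ) • u + (k' * n + l' * n' : ℤ) • v := by module
        rw [ea, eb, dot_diagVec h] at h1
        have h2 : (0 : ℤ) ≤ (k * m + l * m') * (-(k' * m + l' * m')) +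
          -(k * n + l * n') * (k' * n + l' * n') := by exact_mod_cast h1
        have h3 : (0 : ℤ) < k * l' + l * k' := by
          have : (0 : ℤ) ≤ k * l' + l * k' := by positivity
          rcases this.eq_or_lt with h | h
          · exfalso
            have h5 : (0 : ℤ) ≤ k * l' := by positivity
            have h6 : (0 : ℤ) ≤ l * k' := by positivity
            have h7 : (k : ℤ) * l' = 0 := by linarith
            have h8 : (l : ℤ) * k' = 0 := by linarith
            rw [h7, h8] at hd'
            norm_num at hd'
          · exact h
        have h4 := mul_pos h3 hmm
        have h5 : (0 : ℤ) ≤ k * k' * (m * m + n * n) := by positivity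
        have h6 : (0 : ℤ) ≤ l * l' * (m' * m' + n' * n') := by positivity
        linarith

theorem exists_dot_nonneg (F : Finset V) (hF : ∀ x ∈ F, x ∈ P) :
    ∃ n : V, n ≠ 0 ∧ ∀ x ∈ F, 0 ≤ dot n x := by
  by_cases Hout : ∀ u v, Unimod u v → edgeRoot u v ∈ P → edgeRoot u (u + v) ∈ P
  · obtain ⟨u, v, h, -, hpos⟩ := hP.exists_diagVec Hout F hF
    exact ⟨_, diagVec_ne_zero h, hpos⟩
  by_cases Hin : ∀ u v, Unimod u v → edgeRoot u v ∉ P → edgeRoot u (u + v) ∉ P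
  · classical
    obtain ⟨u, v, h, -, hpos⟩ := hP.opp.exists_diagVec (fun u v h he => by
      rw [← hP.not_mem_edge h.add_right]
      rw [← hP.not_mem_edge h] at he
      exact Hin u v h he) (F.image Neg.neg) (by
        intro x hx
        obtain ⟨y, hy, rfl⟩ := Finset.mem_image.1 hx
        simpa using hF y hy)
    refine ⟨-diagVec u v, neg_ne_zero.2 (diagVec_ne_zero h), fun x hx => ?_⟩
    have := hpos (-x) (Finset.mem_image_of_mem _ hx)
    rwa [dot_neg_left, ← dot_neg_right]
  push Not at Hout Hin
  obtain ⟨b, v, hb, hb1, hb2⟩ := Hout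
  obtain ⟨w, z, hw, hw1, hw2⟩ := Hin
  obtain ⟨c₁, d₁, c₂, d₂, h1, h2, hpos⟩ := hP.exists_nonneg_of_mixed hb
    (hP.not_Wl_of_two_outs hb hb1 hb2) hw (hP.not_Bl_of_two_ins hw hw1 hw2)
  refine ⟨formVec (2 * (c₁ * c₂)) (2 * (d₁ * d₂)) (c₁ * d₂ + c₂ * d₁), fun h0 => ?_,
    fun x hx => ?_⟩
  · obtain ⟨hA, hC, hD⟩ := formVec_eq_zero h0
    have e1 : c₁ * c₂ = 0 := by linarith
    have e2 : d₁ * d₂ = 0 := by linarith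
    rcases mul_eq_zero.1 e1 with rfl | rfl
    · have hd1 : d₁ ≠ 0 := h1.resolve_left (by simp)
      have : d₂ = 0 := (mul_eq_zero.1 e2).resolve_left hd1
      subst this
      have : c₂ = 0 := by simpa [hd1] using hD
      simp [this] at h2
    · have hd2 : d₂ ≠ 0 := h2.resolve_left (by simp)
      have : d₁ = 0 := (mul_eq_zero.1 e2).resolve_right hd2
      subst this
      have : c₁ = 0 := by simpa [hd2] using hD
      simp [this] at h1
  · obtain ⟨p, q, hpq, rfl⟩ := mem_Φ_iff.1 (hP.sub (hF x hx))
    have := hpos p q hpq (hF _ hx)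
    rw [dot_formVec]
    simp only [lin] at this
    linarith

end HalfSystem

/-- The cross product of two vectors. -/
def cross (a b : V) : V :=
  ![a 1 * b 2 - a 2 * b 1, a 2 * b 0 - a 0 * b 2, a 0 * b 1 - a 1 * b 0]

theorem dot_add (n x y : V) : dot n (x + y) = dot n x + dot n y := by
  simp only [dot, Pi.add_apply]; ring

theorem dot_smul (n : V) (c : ℝ) (x : V) : dot n (c • x) = c * dot n x := by
  simp only [dot, Pi.smul_apply, smul_eq_mul]; ring

theorem dot_cross_left (a b : V) : dot (cross a b) a = 0 := by
  simp [dot, cross]; ring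

theorem dot_cross_right (a b : V) : dot (cross a b) b = 0 := by
  simp [dot, cross]; ring

theorem dot_α (n : V) (i : Fin 3) : dot n (α i) = n i := by
  fin_cases i <;> simp [dot, α]

theorem dot_self_pos {n : V} (hn : n ≠ 0) : 0 < dot n n := by
  have h : 0 ≤ dot n n := by
    simp only [dot]; nlinarith [mul_self_nonneg (n 0), mul_self_nonneg (n 1), mul_self_nonneg (n 2)]
  refine h.lt_of_ne fun h0 => hn ?_
  simp only [dot] at h0
  ext i
  fin_cases i <;> simp only [Fin.zero_eta, Fin.mk_one, Fin.reduceFinMk, Pi.zero_apply] <;>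
    nlinarith [mul_self_nonneg (n 0), mul_self_nonneg (n 1), mul_self_nonneg (n 2)]

/-- The area form on the plane orthogonal to `n`. -/
def area (n a b : V) : ℝ := dot n (cross a b)

theorem area_swap (n a b : V) : area n a b = -area n b a := by
  simp [area, dot, cross]; ring

theorem area_self_cross (a b : V) : area (cross a b) a b = dot (cross a b) (cross a b) := rfl

theorem area_smul_eq {n a b c : V} (hn : n ≠ 0) (ha : dot n a = 0) (hb : dot n b = 0)
    (hc : dot n c = 0) : area n a b • c = area n c b • a + area n a c • b := by
  have hd : area a b c = 0 := by
    refine (mul_eq_zero.1 ?_).resolve_left (dot_self_pos hn).ne'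
    have : dot n n * area a b c =
        area n b c * dot n a - area n a c * dot n b + area n a b * dot n c := by
      simp [area, dot, cross]; ring
    rw [this, ha, hb, hc]; ring
  have key : ∀ i, area n a b * c i = area n c b * a i + area n a c * b i + area a b c * n i := by
    intro i
    fin_cases i <;> simp [area, dot, cross] <;> ring
  ext i
  simpa [hd] using key i

theorem cross_eq_zero_of_area {n a b : V} (hn : n ≠ 0) (ha : dot n a = 0) (hb : dot n b = 0)
    (h : area n a b = 0) : cross a b = 0 := by
  by_contra hc
  have h1 : dot n n * dot (cross a b) (cross a b) = 0 := by
    have : dot n n * dot (cross a b) (cross a b) = area n a b * area n a b +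
        dot n a * (dot n a * dot b b - dot n b * dot a b) -
        dot n b * (dot n a * dot a b - dot n b * dot a a) := by
      simp [area, dot, cross]; ring
    rw [this, h, ha, hb]; ring
  exact (mul_pos (dot_self_pos hn) (dot_self_pos hc)).ne' h1

theorem smul_eq_of_cross_eq_zero {a b : V} (h : cross a b = 0) :
    (b 0 + b 1 + b 2) • a = (a 0 + a 1 + a 2) • b := by
  have h0 := congrFun h 0
  have h1 := congrFun h 1
  have h2 := congrFun h 2
  simp only [cross, Matrix.cons_val, Pi.zero_apply] at h0 h1 h2
  ext i
  fin_cases i <;> simp only [Fin.zero_eta, Fin.mk_one, Fin.reduceFinMk, Pi.smul_apply, smul_eq_mul]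
  · linarith
  · linarith
  · linarith

theorem sum_pos_of_nonneg {a : V} (h : ∀ i, 0 ≤ a i) (h0 : a ≠ 0) : 0 < a 0 + a 1 + a 2 := by
  have := h 0; have := h 1; have := h 2
  refine lt_of_le_of_ne (by linarith) fun he => h0 ?_
  ext i
  fin_cases i <;> simp only [Fin.zero_eta, Fin.mk_one, Fin.reduceFinMk, Pi.zero_apply] <;> linarith

theorem coeff_nonneg {x y : V} {c : ℝ} (hx : ∀ i, 0 ≤ x i) (hx0 : x ≠ 0) (hy : ∀ i, 0 ≤ y i)
    (h : c • x = y) : 0 ≤ c := by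
  have hs := sum_pos_of_nonneg hx hx0
  have h' : c * (x 0 + x 1 + x 2) = y 0 + y 1 + y 2 := by
    simp only [← h, Pi.smul_apply, smul_eq_mul]; ring
  by_contra! hc
  have := hy 0; have := hy 1; have := hy 2
  nlinarith [mul_pos_of_neg_of_neg hc (neg_lt_zero.2 hs)]

theorem combo_nonneg {x y : V} {s t : ℝ} (hx : ∀ i, 0 ≤ x i) (hy : ∀ i, 0 ≤ y i) (hs : 0 ≤ s)
    (ht : 0 ≤ t) (i : Fin 3) : 0 ≤ (s • x + t • y) i := by
  simp only [Pi.add_apply, Pi.smul_apply, smul_eq_mul]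
  exact add_nonneg (mul_nonneg hs (hx i)) (mul_nonneg ht (hy i))

theorem area_nonneg_of_between {n a b x : V} (hn : n ≠ 0) (ha : dot n a = 0) (hb : dot n b = 0)
    (hx : dot n x = 0) (ha0 : ∀ i, 0 ≤ a i) (hb0 : ∀ i, 0 ≤ b i) (hx0 : ∀ i, 0 ≤ x i)
    (hxz : x ≠ 0) (hax : 0 ≤ area n a x) (hxb : 0 ≤ area n x b) : 0 ≤ area n a b :=
  coeff_nonneg hx0 hxz (combo_nonneg ha0 hb0 hxb hax) (area_smul_eq hn ha hb hx)

theorem exists_smul_eq_of_between {n a b c x : V} (hn : n ≠ 0) (ha : dot n a = 0)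
    (hb : dot n b = 0) (hc : dot n c = 0) (hx : dot n x = 0)
    (ha0 : ∀ i, 0 ≤ a i) (hb0 : ∀ i, 0 ≤ b i) (hc0 : ∀ i, 0 ≤ c i) (hx0 : ∀ i, 0 ≤ x i)
    (haz : a ≠ 0) (hbz : b ≠ 0) (hcz : c ≠ 0) (hxz : x ≠ 0)
    (hax : 0 ≤ area n a x) (hxb : 0 ≤ area n x b) (hcx : 0 ≤ area n c x) (hac : 0 ≤ area n a c) :
    ∃ e s t : ℝ, 0 < e ∧ 0 ≤ s ∧ 0 ≤ t ∧ e • c = s • a + t • b := by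
  have hab := area_nonneg_of_between hn ha hb hx ha0 hb0 hx0 hxz hax hxb
  have hcb := area_nonneg_of_between hn hc hb hx hc0 hb0 hx0 hxz hcx hxb
  have key := area_smul_eq hn ha hb hc
  rcases hab.lt_or_eq with h | h
  · exact ⟨_, _, _, h, hcb, hac, key⟩
  · rw [← h, zero_smul] at key
    have hac' : area n a c = 0 := by
      by_contra hne
      have hpos : 0 < area n a c := hac.lt_of_ne' hne
      apply hbz
      ext i
      have := congrFun key i
      simp only [Pi.zero_apply, Pi.add_apply, Pi.smul_apply, smul_eq_mul] at this ⊢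
      have h1 := mul_nonneg hcb (ha0 i)
      have h2 := hb0 i
      by_contra hbi
      have := mul_pos hpos (h2.lt_of_ne' hbi)
      linarith
    refine ⟨_, _, 0, sum_pos_of_nonneg ha0 haz, (sum_pos_of_nonneg hc0 hcz).le, le_rfl, ?_⟩
    rw [zero_smul, add_zero, smul_eq_of_cross_eq_zero (cross_eq_zero_of_area hn ha hc hac')]

theorem nnspan_induction {X : Set V} {p : ∀ x, x ∈ nnspan X → Prop}
    (mem : ∀ (x : V) (h : x ∈ X), p x (subset_nnspan h)) (zero : p 0 (Submodule.zero_mem _))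
    (add : ∀ x y hx hy, p x hx → p y hy → p (x + y) (nnspan_add_mem hx hy))
    (smul : ∀ (c : ℝ) x hx (hc : 0 ≤ c), p x hx → p (c • x) (nnspan_smul_mem hx hc)) {x : V}
    (hx : x ∈ nnspan X) : p x hx :=
  Submodule.span_induction (p := p) mem zero add (fun c x hx => smul c x hx c.2) hx

theorem dot_zero_right (n : V) : dot n 0 = 0 := by simp [dot]

theorem dot_nonneg_of_mem_nnspan {X : Set V} {n : V} (h : ∀ x ∈ X, 0 ≤ dot n x) {x : V}
    (hx : x ∈ nnspan X) :
    0 ≤ dot n x ∧ (dot n x = 0 → x ∈ nnspan {y ∈ X | dot n y = 0}) := by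
  induction hx using nnspan_induction with
  | mem x hx => exact ⟨h x hx, fun h0 => subset_nnspan ⟨hx, h0⟩⟩
  | zero => exact ⟨(dot_zero_right n).ge, fun _ => Submodule.zero_mem _⟩
  | add x y _ _ hx hy =>
    rw [dot_add]
    refine ⟨add_nonneg hx.1 hy.1, fun h0 => ?_⟩
    have h1 := hx.1
    have h2 := hy.1
    exact nnspan_add_mem (hx.2 (by linarith)) (hy.2 (by linarith))
  | smul c x _ hc hx =>
    rw [dot_smul]
    refine ⟨mul_nonneg hc hx.1, fun h0 => ?_⟩
    rcases mul_eq_zero.1 h0 with rfl | h0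
    · rw [zero_smul]; exact Submodule.zero_mem _
    · exact nnspan_smul_mem (hx.2 h0) hc

theorem exists_dot_nonpos_of_mem_nnspan {X : Set V} {k x : V} (hx : x ∈ nnspan X) (hx0 : x ≠ 0)
    (hk : dot k x = 0) : ∃ y ∈ X, dot k y ≤ 0 := by
  by_contra! h
  have : x = 0 ∨ 0 < dot k x := by
    clear hk hx0
    induction hx using nnspan_induction with
    | mem x hx => exact Or.inr (h x hx)
    | zero => exact Or.inl rfl
    | add x y _ _ hx hy =>
      rcases hx with rfl | hx
      · simpa using hy
      · rcases hy with rfl | hy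
        · simpa using Or.inr hx
        · rw [dot_add]; exact Or.inr (add_pos hx hy)
    | smul c x _ hc hx =>
      rcases hx with rfl | hx
      · simp
      · rcases hc.eq_or_lt with rfl | hc
        · simp
        · rw [dot_smul]; exact Or.inr (mul_pos hc hx)
  rcases this with h' | h'
  · exact hx0 h'
  · exact h'.ne' hk

theorem exists_finset_of_mem_nnspan {X : Set V} {x : V} (hx : x ∈ nnspan X) :
    ∃ F : Finset V, ↑F ⊆ X ∧ x ∈ nnspan F :=
  Submodule.mem_span_finite_of_mem_span hx

theorem nnspan_nonneg {X : Set V} (hX : X ⊆ Φpos) {x : V} (hx : x ∈ nnspan X) (i : Fin 3) :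
    0 ≤ x i := by
  induction hx using nnspan_induction with
  | mem x hx => exact nonneg_of_mem_Φpos (hX hx) i
  | zero => simp
  | add x y _ _ hx hy => exact add_nonneg hx hy
  | smul c x _ hc hx => exact mul_nonneg hc hx

theorem dot_cross_eq_area (n x y : V) : dot (cross n x) y = area n x y := by
  simp [area, dot, cross]; ring

theorem exists_around_of_mem_nnspan {X : Set V} {n x : V} (hx : x ∈ nnspan X) (hx0 : x ≠ 0) :
    (∃ a ∈ X, 0 ≤ area n a x) ∧ ∃ b ∈ X, 0 ≤ area n x b := by
  constructor
  · obtain ⟨a, ha, h⟩ := exists_dot_nonpos_of_mem_nnspan (k := cross n x) hx hx0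
      (dot_cross_right n x)
    rw [dot_cross_eq_area, area_swap] at h
    exact ⟨a, ha, by linarith⟩
  · obtain ⟨b, hb, h⟩ := exists_dot_nonpos_of_mem_nnspan (k := cross x n) hx hx0
      (dot_cross_left x n)
    refine ⟨b, hb, ?_⟩
    have : dot (cross x n) b = -area n x b := by
      simp [area, dot, cross]; ring
    linarith

/-- The cones spanned by a biclosed set and by its complement meet only in the origin. -/
theorem IsBiclosed.eq_zero_of_mem_nnspan {R : Set V} (hR : IsBiclosed R) {x : V}
    (hx : x ∈ nnspan R) (hx' : x ∈ nnspan (Φpos \ R)) : x = 0 := by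
  classical
  by_contra hxz
  obtain ⟨F, hFR, hxF⟩ := exists_finset_of_mem_nnspan hx
  obtain ⟨G, hGR, hxG⟩ := exists_finset_of_mem_nnspan hx'
  obtain ⟨n, hn, hpos⟩ := hR.halfSystem.exists_dot_nonneg (F ∪ G.image (fun y => -y)) (by
    intro y hy
    rcases Finset.mem_union.1 hy with hy | hy
    · exact Or.inl (hFR hy)
    · obtain ⟨z, hz, rfl⟩ := Finset.mem_image.1 hy
      exact Or.inr (by simpa using hGR hz))
  have hF : ∀ y ∈ (F : Set V), 0 ≤ dot n y := fun y hy => hpos y (Finset.mem_union_left _ hy)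
  have hG : ∀ y ∈ (G : Set V), 0 ≤ dot (-n) y := fun y hy => by
    have := hpos (-y) (Finset.mem_union_right _ (Finset.mem_image_of_mem _ hy))
    simpa only [dot_neg_left, dot_neg_right] using this
  obtain ⟨h1, h1'⟩ := dot_nonneg_of_mem_nnspan hF hxF
  obtain ⟨h2, h2'⟩ := dot_nonneg_of_mem_nnspan hG hxG
  have hnx : dot n x = 0 := by
    rw [dot_neg_left] at h2
    linarith
  have hn'x : dot (-n) x = 0 := by rw [dot_neg_left, hnx, neg_zero]
  obtain ⟨⟨a, ⟨haF, ha⟩, hax⟩, ⟨b, ⟨hbF, hb⟩, hxb⟩⟩ :=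
    exists_around_of_mem_nnspan (n := n) (h1' hnx) hxz
  obtain ⟨⟨c, ⟨hcG, hc⟩, hcx⟩, ⟨d, ⟨hdG, hd⟩, hxd⟩⟩ :=
    exists_around_of_mem_nnspan (n := n) (h2' hn'x) hxz
  rw [dot_neg_left, neg_eq_zero] at hc hd
  have haR := hFR haF
  have hbR := hFR hbF
  have hcR := hGR hcG
  have hdR := hGR hdG
  have hx0 := nnspan_nonneg hR.1 hx
  have nonneg {y : V} (hy : y ∈ Φpos) := nonneg_of_mem_Φpos hy
  have nez {y : V} (hy : y ∈ Φpos) := ne_zero_of_mem_Φpos hy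
  rcases le_total 0 (area n a c) with h | h
  · obtain ⟨e, s, t, he, hs, ht, key⟩ := exists_smul_eq_of_between hn ha hb hc hnx
      (nonneg (hR.1 haR)) (nonneg (hR.1 hbR)) (nonneg hcR.1) hx0
      (nez (hR.1 haR)) (nez (hR.1 hbR)) (nez hcR.1) hxz hax hxb hcx h
    exact hcR.2 (hR.2.1.mem haR hbR hcR.1 he hs ht key)
  · have h' : 0 ≤ area n c a := by rw [area_swap]; linarith
    obtain ⟨e, s, t, he, hs, ht, key⟩ := exists_smul_eq_of_between hn hc hd ha hnx
      (nonneg hcR.1) (nonneg hdR.1) (nonneg (hR.1 haR)) hx0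
      (nez hcR.1) (nez hdR.1) (nez (hR.1 haR)) hxz hcx hxd hax h'
    exact (hR.2.2.mem hcR hdR (hR.1 haR) he hs ht key).2 haR

theorem cone_trichotomy {w₁ w₂ b y : V} {p q s t : ℝ} (h₁ : ∀ i, 0 ≤ w₁ i) (h₂ : ∀ i, 0 ≤ w₂ i)
    (hy : ∀ i, 0 ≤ y i) (hy0 : y ≠ 0) (hp : 0 < p) (hq : 0 < q) (hb : b = p • w₁ + q • w₂)
    (hyst : y = s • w₁ + t • w₂) :
    (0 ≤ s ∧ 0 ≤ t) ∨ (∃ e c d : ℝ, 0 < e ∧ 0 ≤ c ∧ 0 ≤ d ∧ e • w₁ = c • y + d • b) ∨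
      ∃ e c d : ℝ, 0 < e ∧ 0 ≤ c ∧ 0 ≤ d ∧ e • w₂ = c • y + d • b := by
  have hneg : ¬(s ≤ 0 ∧ t ≤ 0) := by
    rintro ⟨hs, ht⟩
    have hsum := sum_pos_of_nonneg hy hy0
    have := combo_nonneg h₁ h₂ (neg_nonneg.2 hs) (neg_nonneg.2 ht)
    have e : (-s) • w₁ + (-t) • w₂ = -y := by rw [hyst]; module
    rw [e] at this
    have h0 := this 0; have h1 := this 1; have h2 := this 2
    simp only [Pi.neg_apply] at h0 h1 h2
    linarith
  by_cases hs : 0 ≤ s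
  · by_cases ht : 0 ≤ t
    · exact Or.inl ⟨hs, ht⟩
    · push Not at ht
      have hs' : 0 < s := by
        by_contra! h
        exact hneg ⟨h, ht.le⟩
      refine Or.inr (Or.inl ⟨s * q + (-t) * p, q, -t, ?_, hq.le, by linarith, ?_⟩)
      · nlinarith [mul_pos hs' hq, mul_pos (neg_pos.2 ht) hp]
      · rw [hyst, hb]; module
  · push Not at hs
    have ht' : 0 < t := by
      by_contra! h
      exact hneg ⟨hs.le, h⟩
    refine Or.inr (Or.inr ⟨t * p + (-s) * q, p, -s, ?_, hp.le, by linarith, ?_⟩)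
    · nlinarith [mul_pos ht' hp, mul_pos (neg_pos.2 hs) hq]
    · rw [hyst, hb]; module

theorem exists_combo_of_dot_cross {w₁ w₂ y : V} (hN : cross w₁ w₂ ≠ 0)
    (hy : dot (cross w₁ w₂) y = 0) : ∃ s t : ℝ, y = s • w₁ + t • w₂ := by
  have key := area_smul_eq hN (dot_cross_left _ _) (dot_cross_right _ _) hy
  have hpos := dot_self_pos hN
  rw [← area_self_cross] at hpos
  set D := area (cross w₁ w₂) w₁ w₂
  refine ⟨D⁻¹ * area (cross w₁ w₂) y w₂, D⁻¹ * area (cross w₁ w₂) w₁ y, ?_⟩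
  rw [mul_smul, mul_smul, ← smul_add, ← key, smul_smul, inv_mul_cancel₀ hpos.ne', one_smul]

theorem cross_apply_eq_zero {a b : V} {i k : Fin 3} (hik : k ≠ i) (ha : a k = 0) (hb : b k = 0) :
    cross a b i = 0 := by
  fin_cases i <;> fin_cases k <;> simp_all [cross]

theorem α_mem_Φpos (i : Fin 3) : α i ∈ Φpos := ⟨α_mem_Φ i, subset_nnspan ⟨i, rfl⟩⟩

theorem IsBiclosed.exists_α_mem {R : Set V} (hR : IsBiclosed R) {r : V} (hr : r ∈ nnspan R)
    (hr0 : r ≠ 0) : ∃ i, α i ∈ R := by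
  by_contra! h
  refine hr0 (hR.eq_zero_of_mem_nnspan hr ?_)
  refine nnspan_mono ?_ (mem_nnspan_Δ.2 (nnspan_nonneg hR.1 hr))
  rintro _ ⟨i, rfl⟩
  exact ⟨α_mem_Φpos i, h i⟩

theorem combo_ne_zero {x : V} {i : Fin 3} {s t : ℝ} (hx : ∀ i, 0 ≤ x i) (hs : 0 ≤ s) (ht : 0 < t) :
    s • x + t • α i ≠ 0 := by
  intro h
  have := congrFun h i
  have h1 := mul_nonneg hs (hx i)
  simp [α] at this
  linarith

theorem exists_pos_combo_eq_zero {a b : ℝ} (ha : a ≠ 0) (h : a * b ≤ 0) :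
    ∃ s t : ℝ, 0 ≤ s ∧ 0 < t ∧ s * a + t * b = 0 := by
  refine ⟨|b|, |a|, abs_nonneg b, abs_pos.2 ha, ?_⟩
  rcases ha.lt_or_gt with ha | ha
  · have : 0 ≤ b := by
      by_contra! hb
      nlinarith [mul_pos_of_neg_of_neg ha hb]
    rw [abs_of_nonneg this, abs_of_neg ha]; ring
  · have : b ≤ 0 := by
      by_contra! hb
      nlinarith [mul_pos ha hb]
    rw [abs_of_nonpos this, abs_of_pos ha]; ring

theorem dot_mul_dot_α_pos {R : Set V} (hR : R ⊆ Φpos) {N : V}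
    (hN : ∀ y ∈ nnspan R, y ≠ 0 → dot N y ≠ 0) {r : V} (hr : r ∈ nnspan R) (hr0 : r ≠ 0)
    {i : Fin 3} (hi : α i ∈ R) : 0 < dot N r * dot N (α i) := by
  by_contra! h
  obtain ⟨s, t, hs, ht, h0⟩ := exists_pos_combo_eq_zero (hN r hr hr0) h
  refine hN _ (nnspan_add_mem (nnspan_smul_mem hr hs)
    (nnspan_smul_mem (subset_nnspan hi) ht.le)) (combo_ne_zero (nnspan_nonneg hR hr) hs ht) ?_
  rw [dot_add, dot_smul, dot_smul, h0]

/-- The positive roots in the cone spanned by a set. -/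
def rootHull (X : Set V) : Set V := Φpos ∩ nnspan X

theorem mem_rootHull_of_smul {X : Set V} {w : V} (hw : w ∈ Φpos) {e : ℝ} (he : 0 < e)
    (h : e • w ∈ nnspan X) : w ∈ rootHull X := by
  refine ⟨hw, ?_⟩
  have := nnspan_smul_mem h (inv_nonneg.2 he.le)
  rwa [smul_smul, inv_mul_cancel₀ he.ne', one_smul] at this

theorem isClosedSet_rootHull (X : Set V) : IsClosedSet (rootHull X) := by
  rintro a ha b hb z ⟨hz, hz'⟩
  obtain ⟨s, t, hs, ht, rfl⟩ := mem_nnspan_pair.1 hz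
  exact ⟨hz', nnspan_add_mem (nnspan_smul_mem ha.2 hs) (nnspan_smul_mem hb.2 ht)⟩

theorem isClosedSet_compl_rootHull_union {R₁ R₂ : Set V} (hR₁ : IsBiclosed R₁)
    (hR₂ : IsBiclosed R₂) : IsClosedSet (Φpos \ rootHull (R₁ ∪ R₂)) := by
  rintro w₁ ⟨hw₁, hw₁'⟩ w₂ ⟨hw₂, hw₂'⟩ b ⟨hb, hbpos⟩
  refine ⟨hbpos, fun hbJ => ?_⟩
  obtain ⟨p, q, hp, hq, hbpq⟩ := mem_nnspan_pair.1 hb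
  have hw₁0 := nonneg_of_mem_Φpos hw₁
  have hw₂0 := nonneg_of_mem_Φpos hw₂
  have hbz := ne_zero_of_mem_Φpos hbpos
  have hbX := hbJ.2
  have no₁ {e : ℝ} (he : 0 < e) (h : e • w₁ ∈ nnspan (R₁ ∪ R₂)) : False :=
    hw₁' (mem_rootHull_of_smul hw₁ he h)
  have no₂ {e : ℝ} (he : 0 < e) (h : e • w₂ ∈ nnspan (R₁ ∪ R₂)) : False :=
    hw₂' (mem_rootHull_of_smul hw₂ he h)
  have pos_of {y : V} (hy : y ∈ nnspan (R₁ ∪ R₂)) (hy0 : y ≠ 0) {s t : ℝ} (hs : 0 ≤ s)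
      (ht : 0 ≤ t) (hst : y = s • w₁ + t • w₂) : 0 < s ∧ 0 < t := by
    constructor
    · refine hs.lt_of_ne' ?_
      rintro rfl
      rw [zero_smul, zero_add] at hst
      refine no₂ (ht.lt_of_ne' ?_) (hst ▸ hy)
      rintro rfl
      exact hy0 (by simpa using hst)
    · refine ht.lt_of_ne' ?_
      rintro rfl
      rw [zero_smul, add_zero] at hst
      refine no₁ (hs.lt_of_ne' ?_) (hst ▸ hy)
      rintro rfl
      exact hy0 (by simpa using hst)
  obtain ⟨hp, hq⟩ := pos_of hbX hbz hp hq hbpq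
  have hsum₁ := sum_pos_of_nonneg hw₁0 (ne_zero_of_mem_Φpos hw₁)
  have hsum₂ := sum_pos_of_nonneg hw₂0 (ne_zero_of_mem_Φpos hw₂)
  have hN : cross w₁ w₂ ≠ 0 := by
    intro h
    have h := smul_eq_of_cross_eq_zero h
    refine no₁ (e := (w₁ 0 + w₁ 1 + w₁ 2) * p + (w₂ 0 + w₂ 1 + w₂ 2) * q) (by positivity) ?_
    have : ((w₁ 0 + w₁ 1 + w₁ 2) * p + (w₂ 0 + w₂ 1 + w₂ 2) * q) • w₁ =
        (w₁ 0 + w₁ 1 + w₁ 2) • b := by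
      calc _ = ((w₁ 0 + w₁ 1 + w₁ 2) * p) • w₁ + q • ((w₂ 0 + w₂ 1 + w₂ 2) • w₁) := by module
        _ = _ := by rw [h, hbpq]; module
    rw [this]
    exact nnspan_smul_mem hbX hsum₁.le
  have hX : R₁ ∪ R₂ ⊆ Φpos := Set.union_subset hR₁.1 hR₂.1
  have cone {y : V} (hy : y ∈ nnspan (R₁ ∪ R₂)) (hy0 : y ≠ 0) (hd : dot (cross w₁ w₂) y = 0) :
      ∃ s t : ℝ, 0 ≤ s ∧ 0 ≤ t ∧ y = s • w₁ + t • w₂ := by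
    obtain ⟨s, t, hst⟩ := exists_combo_of_dot_cross hN hd
    rcases cone_trichotomy hw₁0 hw₂0 (nnspan_nonneg hX hy) hy0 hp hq hbpq hst with
      ⟨hs, ht⟩ | ⟨e, c, d, he, hc, hd, key⟩ | ⟨e, c, d, he, hc, hd, key⟩
    · exact ⟨s, t, hs, ht, hst⟩
    · exact (no₁ he (key ▸ nnspan_add_mem (nnspan_smul_mem hy hc) (nnspan_smul_mem hbX hd))).elim
    · exact (no₂ he (key ▸ nnspan_add_mem (nnspan_smul_mem hy hc) (nnspan_smul_mem hbX hd))).elim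
  have dot_ne {R : Set V} (hR : IsBiclosed R) (hRX : R ⊆ R₁ ∪ R₂) :
      ∀ y ∈ nnspan R, y ≠ 0 → dot (cross w₁ w₂) y ≠ 0 := by
    intro y hy hy0 hd
    obtain ⟨s, t, hs, ht, hst⟩ := cone (nnspan_mono hRX hy) hy0 hd
    refine hy0 (hR.eq_zero_of_mem_nnspan hy ?_)
    rw [hst]
    exact nnspan_add_mem
      (nnspan_smul_mem (subset_nnspan (X := Φpos \ R)
        ⟨hw₁, fun h => hw₁' ⟨hw₁, subset_nnspan (hRX h)⟩⟩) hs)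
      (nnspan_smul_mem (subset_nnspan (X := Φpos \ R)
        ⟨hw₂, fun h => hw₂' ⟨hw₂, subset_nnspan (hRX h)⟩⟩) ht)
  have dot_ne₁ := dot_ne hR₁ Set.subset_union_left
  have dot_ne₂ := dot_ne hR₂ Set.subset_union_right
  have hbd : dot (cross w₁ w₂) b = 0 := by
    rw [hbpq, dot_add, dot_smul, dot_smul, dot_cross_left, dot_cross_right]; ring
  obtain ⟨r₁, hr₁, r₂, hr₂, hr⟩ : ∃ r₁ ∈ nnspan R₁, ∃ r₂ ∈ nnspan R₂, r₁ + r₂ = b := by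
    have h := hbX
    rw [nnspan, Submodule.span_union] at h
    exact Submodule.mem_sup.1 h
  have hr₁0 : r₁ ≠ 0 := by
    rintro rfl
    rw [zero_add] at hr
    exact dot_ne₂ b (hr ▸ hr₂) hbz hbd
  have hr₂0 : r₂ ≠ 0 := by
    rintro rfl
    rw [add_zero] at hr
    exact dot_ne₁ b (hr ▸ hr₁) hbz hbd
  obtain ⟨i, hi⟩ := hR₁.exists_α_mem hr₁ hr₁0
  obtain ⟨j, hj⟩ := hR₂.exists_α_mem hr₂ hr₂0
  have h₁ := dot_mul_dot_α_pos hR₁.1 dot_ne₁ hr₁ hr₁0 hi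
  have h₂ := dot_mul_dot_α_pos hR₂.1 dot_ne₂ hr₂ hr₂0 hj
  have hneg : dot (cross w₁ w₂) (α i) * dot (cross w₁ w₂) (α j) < 0 := by
    rw [← hr, dot_add] at hbd
    rw [eq_neg_of_add_eq_zero_right hbd] at h₂
    have := mul_pos h₁ h₂
    by_contra! h
    nlinarith [mul_nonneg (mul_self_nonneg (dot (cross w₁ w₂) r₁)) h]
  obtain ⟨s, t, hs, ht, hst⟩ :=
    exists_pos_combo_eq_zero (left_ne_zero_of_mul hneg.ne) hneg.le
  have hα (k : Fin 3) := nonneg_of_mem_Φpos (α_mem_Φpos k)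
  have hyX : s • α i + t • α j ∈ nnspan (R₁ ∪ R₂) :=
    nnspan_add_mem (nnspan_smul_mem (subset_nnspan (Or.inl hi)) hs)
      (nnspan_smul_mem (subset_nnspan (Or.inr hj)) ht.le)
  have hy0 : s • α i + t • α j ≠ 0 := combo_ne_zero (hα i) hs ht
  obtain ⟨c, d, hc, hd, hcd⟩ := cone hyX hy0 (by rw [dot_add, dot_smul, dot_smul, hst])
  obtain ⟨hc, hd⟩ := pos_of hyX hy0 hc hd hcd
  obtain ⟨k, hki, hkj⟩ : ∃ k : Fin 3, k ≠ i ∧ k ≠ j :=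
    (by decide : ∀ i j : Fin 3, ∃ k, k ≠ i ∧ k ≠ j) i j
  have hk := congrFun hcd k
  simp only [α, Pi.add_apply, Pi.smul_apply, smul_eq_mul, Pi.single_eq_of_ne hki,
    Pi.single_eq_of_ne hkj, mul_zero, add_zero] at hk
  have e₁ := mul_nonneg hc.le (hw₁0 k)
  have e₂ := mul_nonneg hd.le (hw₂0 k)
  have z₁ : w₁ k = 0 := (mul_eq_zero.1 (by linarith : c * w₁ k = 0)).resolve_left hc.ne'
  have z₂ : w₂ k = 0 := (mul_eq_zero.1 (by linarith : d * w₂ k = 0)).resolve_left hd.ne'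
  rw [dot_α, cross_apply_eq_zero hki z₁ z₂, zero_mul] at hneg
  exact hneg.false

theorem isBiclosed_rootHull_union {R₁ R₂ : Set V} (hR₁ : IsBiclosed R₁) (hR₂ : IsBiclosed R₂) :
    IsBiclosed (rootHull (R₁ ∪ R₂)) :=
  ⟨Set.inter_subset_left, isClosedSet_rootHull _, isClosedSet_compl_rootHull_union hR₁ hR₂⟩

theorem IsBiclosed.rootHull_subset {R : Set V} (hR : IsBiclosed R) {X : Set V} (hX : X ⊆ R) :
    rootHull X ⊆ R := by
  rintro b ⟨hb, hbX⟩
  by_contra h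
  exact ne_zero_of_mem_Φpos hb (hR.eq_zero_of_mem_nnspan (nnspan_mono hX hbX)
    (subset_nnspan ⟨hb, h⟩))

theorem exists_join {R₁ R₂ : Set V} (h₁ : IsBiclosed R₁) (h₂ : IsBiclosed R₂) :
    ∃ J : Set V, IsBiclosed J ∧ R₁ ⊆ J ∧ R₂ ⊆ J ∧
      ∀ J' : Set V, IsBiclosed J' → R₁ ⊆ J' → R₂ ⊆ J' → J ⊆ J' :=
  ⟨rootHull (R₁ ∪ R₂), isBiclosed_rootHull_union h₁ h₂,
    fun _ h => ⟨h₁.1 h, subset_nnspan (Or.inl h)⟩, fun _ h => ⟨h₂.1 h, subset_nnspan (Or.inr h)⟩,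
    fun _ hJ' h h' => hJ'.rootHull_subset (Set.union_subset h h')⟩

/-- The extended weak order for `U₃` is a lattice: any two biclosed subsets of `Φ⁺`
have a least upper bound and a greatest lower bound in the poset of biclosed subsets
of `Φ⁺` ordered by inclusion. -/
theorem extended_weak_order_is_lattice (R₁ R₂ : Set V)
    (h₁ : IsBiclosed R₁) (h₂ : IsBiclosed R₂) :
    (∃ J : Set V, IsBiclosed J ∧ R₁ ⊆ J ∧ R₂ ⊆ J ∧
      ∀ J' : Set V, IsBiclosed J' → R₁ ⊆ J' → R₂ ⊆ J' → J ⊆ J') ∧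
    (∃ M : Set V, IsBiclosed M ∧ M ⊆ R₁ ∧ M ⊆ R₂ ∧
      ∀ M' : Set V, IsBiclosed M' → M' ⊆ R₁ → M' ⊆ R₂ → M' ⊆ M) := by
  refine ⟨exists_join h₁ h₂, ?_⟩
  obtain ⟨J, hJ, hJ₁, hJ₂, hmin⟩ := exists_join h₁.compl h₂.compl
  refine ⟨Φpos \ J, hJ.compl, fun x hx => ?_, fun x hx => ?_, fun M hM hM₁ hM₂ x hx => ?_⟩
  · by_contra h
    exact hx.2 (hJ₁ ⟨hx.1, h⟩)
  · by_contra h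
    exact hx.2 (hJ₂ ⟨hx.1, h⟩)
  · exact ⟨hM.1 hx, fun h => (hmin _ hM.compl (Set.sdiff_subset_sdiff_right hM₁)
      (Set.sdiff_subset_sdiff_right hM₂) h).2 hx⟩
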